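/- Let G be a normal subgroup of S_n admitting an ℓ-local base T, and let μ ∈ M_T satisfy μ(σ) = μ(σ⁻¹) and μ(σ) = μ(t⁻¹σt) for all σ ∈ G and t ∈ S_n. Then for all probability measures ν₁, ν₂ on G, T⌢₂(ν₂|ν₁) ≤ 2 c² · ( √H(ν₁|μ) + √H(ν₂|μ) )², where c² = 8(ℓ−1)² + 2. -/

import Mathlib

attribute [local instance] Classical.propDecidable

noncomputable section

/-- Degree (cardinality of the support) of a permutation. -/
noncomputable def degree {n : ℕ} (σ : Equiv.Perm (Fin n)) : ℕ :=
  (Finset.univ.filter fun i => σ i ≠ i).card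

/-- The subgroup `G_j` of elements of `G` fixing every index `> j`. -/
def Gj {n : ℕ} (G : Subgroup (Equiv.Perm (Fin n))) (j : Fin n) :
    Set (Equiv.Perm (Fin n)) :=
  {σ | σ ∈ G ∧ ∀ i : Fin n, j < i → σ i = i}

/-- The orbit `O_j` of `j` under `G_j`. -/
def Orb {n : ℕ} (G : Subgroup (Equiv.Perm (Fin n))) (j : Fin n) : Set (Fin n) :=
  {i | ∃ σ ∈ Gj G j, σ j = i}

/-- An `ℓ`-local base of `G`. -/
def IsLocalBase {n : ℕ} (ℓ : ℕ) (G : Subgroup (Equiv.Perm (Fin n)))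
    (t : Fin n → Fin n → Equiv.Perm (Fin n)) : Prop :=
  ∀ j : Fin n, (j : ℕ) ≠ 0 →
    t j j = 1 ∧ ∀ i ∈ Orb G j, i ≠ j →
      t i j ∈ Gj G j ∧ t i j i = j ∧ degree (t i j) ≤ ℓ

/-- The map `U_T (i_2, …, i_n) = t_{i_2,2} t_{i_3,3} ⋯ t_{i_n,n}`. -/
noncomputable def UT {n : ℕ} (t : Fin n → Fin n → Equiv.Perm (Fin n))
    (i : Fin n → Fin n) : Equiv.Perm (Fin n) :=
  (((List.finRange n).drop 1).map fun j => t (i j) j).prod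

/-- `μ` belongs to the class `M_T`: it is the pushforward under `U_T` of a product
of probability measures on the orbits `O_j`. -/
def MemMT {n : ℕ} (G : Subgroup (Equiv.Perm (Fin n)))
    (t : Fin n → Fin n → Equiv.Perm (Fin n)) (μ : Equiv.Perm (Fin n) → ℝ) : Prop :=
  ∃ νh : Fin n → Fin n → ℝ,
    (∀ j : Fin n,
      (∀ i, 0 ≤ νh j i) ∧ (∀ i, i ∉ Orb G j → νh j i = 0) ∧ ∑ i, νh j i = 1) ∧
    ∀ σ, μ σ = ∑ i : Fin n → Fin n, if UT t i = σ then ∏ j, νh j (i j) else 0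

/-- `K_n`, the number of indices `j ∈ {2, …, n}` with `O_j ≠ {j}`. -/
noncomputable def Kn {n : ℕ} (G : Subgroup (Equiv.Perm (Fin n))) : ℕ :=
  (Finset.univ.filter fun j : Fin n => (j : ℕ) ≠ 0 ∧ Orb G j ≠ {j}).card

/-- Relative entropy `H(ν | μ)` of finitely supported densities; `+∞` if `ν` is not
absolutely continuous with respect to `μ`. -/
noncomputable def relEnt {X : Type*} [Fintype X] (ν μ : X → ℝ) : ENNReal :=
  if ∀ x, μ x = 0 → ν x = 0 then
    ENNReal.ofReal (∑ x, ν x * Real.log (ν x / μ x))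
  else ⊤

/-- `p` is a probability measure supported on the set `S`. -/
def IsProbOn {X : Type*} [Fintype X] (p : X → ℝ) (S : Set X) : Prop :=
  (∀ x, 0 ≤ p x) ∧ (∀ x, x ∉ S → p x = 0) ∧ ∑ x, p x = 1

/-- The weak transport cost `T⌒₂(ν₂ | ν₁)` on a group of permutations
(kernel formulation, `π(σ, τ) = ν₁(σ) p_σ(τ)`). -/
noncomputable def parenT2 {n : ℕ} (ν₁ ν₂ : Equiv.Perm (Fin n) → ℝ) : ℝ :=
  sInf {w | ∃ p : Equiv.Perm (Fin n) → Equiv.Perm (Fin n) → ℝ,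
    (∀ σ τ, 0 ≤ p σ τ) ∧ (∀ σ, ∑ τ, p σ τ = 1) ∧ (∀ τ, ∑ σ, ν₁ σ * p σ τ = ν₂ τ) ∧
    w = ∑ σ, ν₁ σ * ∑ i : Fin n,
      (∑ τ, p σ τ * (if σ i ≠ τ i then (1 : ℝ) else 0)) ^ 2}

/-! ### Finite probability vectors, entropy, and the optimal one-step coupling -/

/-- A probability vector on a finite type. -/
structure IsPr {X : Type*} [Fintype X] (p : X → ℝ) : Prop where
  nonneg : ∀ x, 0 ≤ p x
  sum_one : ∑ x, p x = 1

/-- Real-valued relative entropy of two vectors. -/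
def ent {X : Type*} [Fintype X] (ν μ : X → ℝ) : ℝ := ∑ x, ν x * Real.log (ν x / μ x)

lemma sq_le_two_mul_log_of_le {p q : ℝ} (hp : 0 ≤ p) (hpq : p ≤ q) (hq : 0 < q) :
    (q - p) ^ 2 / q ≤ 2 * (p * Real.log (p / q) - p + q) := by
  rcases hp.eq_or_lt with rfl | hp
  · simp only [sub_zero, zero_mul, zero_add]
    rw [div_le_iff₀ hq]; nlinarith
  set f := p / q with hf
  have hf0 : 0 < f := by positivity
  have hf1 : f ≤ 1 := by rw [hf, div_le_one hq]; exact hpq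
  have hpf : p = f * q := by rw [hf]; field_simp
  have key : f * Real.log f ≥ (f ^ 2 - 1) / 2 := by
    have h1 : 0 ≤ -Real.log f := by
      have := Real.log_nonpos hf0.le hf1
      linarith
    have h2 : -Real.log f ≤ Real.sinh (-Real.log f) := Real.self_le_sinh_iff.mpr h1
    rw [Real.sinh_eq, neg_neg, Real.exp_log hf0, Real.exp_neg, Real.exp_log hf0] at h2
    have h3 : f * -Real.log f ≤ f * ((f⁻¹ - f) / 2) := mul_le_mul_of_nonneg_left h2 hf0.le
    have h4 : f * ((f⁻¹ - f) / 2) = (1 - f ^ 2) / 2 := by field_simp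
    linarith
  rw [hpf]
  have : (q - f * q) ^ 2 / q = q * (1 - f) ^ 2 := by field_simp
  rw [this]
  nlinarith

lemma sq_le_two_mul_log_of_ge {p q : ℝ} (hpq : q ≤ p) (hq : 0 < q) :
    (p - q) ^ 2 / p ≤ 2 * (p * Real.log (p / q) - p + q) := by
  have hp : 0 < p := hq.trans_le hpq
  set x := 1 - q / p with hx
  have hqx : q = (1 - x) * p := by rw [hx]; field_simp; ring
  have hx0 : 0 ≤ x := by rw [hx, sub_nonneg, div_le_one hp]; exact hpq
  have hx1 : x < 1 := by rw [hx]; have : 0 < q / p := by positivity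
                         linarith
  have hs := Real.hasSum_pow_div_log_of_abs_lt_one (x := x) (by rw [abs_of_nonneg hx0]; exact hx1)
  have h2 := sum_le_hasSum (Finset.range 2) (fun i _ => by positivity) hs
  simp only [Finset.sum_range_succ, Finset.sum_range_zero] at h2
  norm_num at h2
  have hl : Real.log (p / q) = -Real.log (1 - x) := by
    have : 1 - x = q / p := by rw [hx]; ring
    rw [this, ← Real.log_inv, inv_div]
  rw [hl]
  have : (p - q) ^ 2 / p = p * x ^ 2 := by rw [hqx]; field_simp; ring
  rw [this, hqx]
  nlinarith

lemma gap_le_two_ent {X : Type*} [Fintype X] {P Q : X → ℝ} (hP : IsPr P) (hQ : IsPr Q)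
    (hac : ∀ x, Q x = 0 → P x = 0) :
    ∑ x, (max (P x - Q x) 0 ^ 2 / P x + max (Q x - P x) 0 ^ 2 / Q x) ≤ 2 * ent P Q := by
  have h : 2 * ent P Q = ∑ x, 2 * (P x * Real.log (P x / Q x) - P x + Q x) := by
    rw [← Finset.mul_sum, Finset.sum_add_distrib, Finset.sum_sub_distrib, hP.sum_one,
      hQ.sum_one, ent]
    ring
  rw [h]
  refine Finset.sum_le_sum fun x _ => ?_
  rcases (hQ.nonneg x).eq_or_lt with h0 | h0
  · simp [hac x h0.symm, ← h0]
  rcases le_total (P x) (Q x) with hle | hle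
  · rw [max_eq_right (by linarith), max_eq_left (by linarith)]
    simpa using sq_le_two_mul_log_of_le (hP.nonneg x) hle h0
  · rw [max_eq_left (by linarith), max_eq_right (by linarith)]
    simpa using sq_le_two_mul_log_of_ge hle h0

lemma ent_self {X : Type*} [Fintype X] (P : X → ℝ) : ent P P = 0 := by
  refine Finset.sum_eq_zero fun x _ => ?_
  by_cases h : P x = 0
  · simp [h]
  · simp [div_self h]

lemma ent_nonneg {X : Type*} [Fintype X] {P Q : X → ℝ} (hP : IsPr P) (hQ : IsPr Q)
    (hac : ∀ x, Q x = 0 → P x = 0) : 0 ≤ ent P Q := by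
  have := gap_le_two_ent hP hQ hac
  have h2 : 0 ≤ ∑ x, (max (P x - Q x) 0 ^ 2 / P x + max (Q x - P x) 0 ^ 2 / Q x) :=
    Finset.sum_nonneg fun x _ => add_nonneg (div_nonneg (sq_nonneg _) (hP.nonneg x))
      (div_nonneg (sq_nonneg _) (hQ.nonneg x))
  linarith

/-- The defining properties of the optimal (total variation) coupling kernel of `P` and `Q`. -/
structure IsTV {X : Type*} [Fintype X] [DecidableEq X] (P Q : X → ℝ) (T : X → X → ℝ) : Prop where
  nonneg : ∀ i c, 0 ≤ T i c
  row : ∀ i, ∑ c, T i c = 1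
  marg : ∀ c, ∑ i, P i * T i c = Q c
  diag : ∀ i, P i * (1 - T i i) = max (P i - Q i) 0
  off : ∀ c, ∑ i, (if i = c then 0 else P i * T i c) = max (Q c - P c) 0

lemma exists_isTV {X : Type*} [Fintype X] [DecidableEq X] {P Q : X → ℝ} (hP : IsPr P)
    (hQ : IsPr Q) :
    ∃ T, IsTV P Q T := by
  set δ : ℝ := ∑ x, max (P x - Q x) 0 with hδ
  have hδ' : ∑ x, max (Q x - P x) 0 = δ := by
    have h : ∑ x, max (P x - Q x) 0 - ∑ x, max (Q x - P x) 0 = ∑ x, P x - ∑ x, Q x := by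
      rw [← Finset.sum_sub_distrib, ← Finset.sum_sub_distrib]
      refine Finset.sum_congr rfl fun x _ => ?_
      rcases le_total (P x) (Q x) with h | h
      · rw [max_eq_right (by linarith), max_eq_left (by linarith)]; ring
      · rw [max_eq_left (by linarith), max_eq_right (by linarith)]; ring
    rw [hP.sum_one, hQ.sum_one] at h
    linarith
  set e : X → ℝ := fun i => max (P i - Q i) 0 / P i with he
  set r : X → ℝ := fun c => max (Q c - P c) 0 / δ with hr
  have hδ0 : 0 ≤ δ := Finset.sum_nonneg fun _ _ => le_max_right _ _
  have he0 : ∀ i, 0 ≤ e i := fun i => div_nonneg (le_max_right _ _) (hP.nonneg i)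
  have he1 : ∀ i, e i ≤ 1 := fun i => by
    refine div_le_one_of_le₀ ?_ (hP.nonneg i)
    exact max_le (by linarith [hQ.nonneg i]) (hP.nonneg i)
  have hPe : ∀ i, P i * e i = max (P i - Q i) 0 := fun i => by
    rcases (hP.nonneg i).eq_or_lt with h | h
    · rw [← h]; simp [hQ.nonneg i]
    · simp only [he]; field_simp
  have hr0 : ∀ c, 0 ≤ r c := fun c => div_nonneg (le_max_right _ _) hδ0
  have her : ∀ i, e i * r i = 0 := fun i => by
    rcases le_total (P i) (Q i) with h | h
    · simp only [he]; rw [max_eq_right (by linarith)]; simp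
    · simp only [hr]; rw [max_eq_right (b := (0 : ℝ)) (by linarith)]; simp
  have hδr : ∀ c, δ * r c = max (Q c - P c) 0 := fun c => by
    rcases hδ0.eq_or_lt with h | h
    · have : max (Q c - P c) 0 = 0 := by
        have h1 := (Finset.sum_eq_zero_iff_of_nonneg
          (f := fun x => max (Q x - P x) 0) (fun x _ => le_max_right _ _)).1 (hδ'.trans h.symm)
        exact h1 c (Finset.mem_univ _)
      rw [this, ← h, zero_mul]
    · simp only [hr]; field_simp
  have her1 : ∀ i, e i * ∑ c, r c = e i := fun i => by
    rcases hδ0.eq_or_lt with h | h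
    · have : max (P i - Q i) 0 = 0 :=
        (Finset.sum_eq_zero_iff_of_nonneg
          (f := fun x => max (P x - Q x) 0) (fun x _ => le_max_right _ _)).1 h.symm i
            (Finset.mem_univ _)
      simp only [he]; rw [this]; simp
    · have : ∑ c, r c = 1 := by
        simp only [hr]; rw [← Finset.sum_div, hδ', div_self h.ne']
      rw [this, mul_one]
  have hPeδ : ∑ i, P i * e i = δ := Finset.sum_congr rfl fun i _ => hPe i
  refine ⟨fun i c => (if i = c then 1 - e i else 0) + e i * r c, ?_, ?_, ?_, ?_, ?_⟩
  · intro i c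
    refine add_nonneg ?_ (mul_nonneg (he0 i) (hr0 c))
    split_ifs
    · linarith [he1 i]
    · exact le_rfl
  · intro i
    rw [Finset.sum_add_distrib, Finset.sum_ite_eq, ← Finset.mul_sum, her1]
    simp
  · intro c
    have : ∀ i, P i * ((if i = c then 1 - e i else 0) + e i * r c) =
        (if i = c then P i * (1 - e i) else 0) + (P i * e i) * r c := by
      intro i; split_ifs <;> ring
    simp only [this]
    rw [Finset.sum_add_distrib, Finset.sum_ite_eq', ← Finset.sum_mul, hPeδ, hδr, mul_sub, hPe]
    simp only [Finset.mem_univ, if_true]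
    rcases le_total (P c) (Q c) with h | h
    · rw [max_eq_right (by linarith), max_eq_left (by linarith)]; ring
    · rw [max_eq_left (by linarith), max_eq_right (by linarith)]; ring
  · intro i
    simp only [if_true, her i, add_zero, sub_sub_cancel]
    exact hPe i
  · intro c
    have : ∀ i, (if i = c then 0 else P i * ((if i = c then 1 - e i else 0) + e i * r c)) =
        P i * e i * r c := by
      intro i
      split_ifs with h
      · subst h; rw [mul_assoc, her, mul_zero]
      · ring
    simp only [this]
    rw [← Finset.sum_mul, hPeδ, hδr]

namespace IsTV

variable {X : Type*} [Fintype X] [DecidableEq X] {P Q : X → ℝ} {T : X → X → ℝ}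

lemma off_row (h : IsTV P Q T) (i : X) : ∑ c ∈ Finset.univ.erase i, T i c = 1 - T i i := by
  rw [← h.row i, ← Finset.add_sum_erase _ _ (Finset.mem_univ i)]; ring

lemma le_off (h : IsTV P Q T) {i c : X} (hic : c ≠ i) : T i c ≤ 1 - T i i := by
  rw [← h.off_row]
  exact Finset.single_le_sum (f := fun c => T i c) (fun c _ => h.nonneg i c) (by simp [hic])

/-- The quadratic cost of the optimal coupling is controlled by the relative entropies. -/
lemma cost_le (h : IsTV P Q T) (hP : IsPr P) (hQ : IsPr Q) {q : X → ℝ}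
    (hPq : ∀ x, q x = 0 → P x = 0) (hQq : ∀ x, q x = 0 → Q x = 0) (hor : P = q ∨ Q = q) :
    ∑ i, P i * (1 - T i i) ^ 2 + ∑ c, max (Q c - P c) 0 ^ 2 / Q c ≤ 2 * (ent P q + ent Q q) := by
  have h1 : ∑ i, P i * (1 - T i i) ^ 2 = ∑ i, max (P i - Q i) 0 ^ 2 / P i := by
    refine Finset.sum_congr rfl fun i _ => ?_
    rw [← h.diag]
    rcases (hP.nonneg i).eq_or_lt with h0 | h0
    · rw [← h0]; simp
    · field_simp
  rw [h1, ← Finset.sum_add_distrib]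
  rcases hor with rfl | rfl
  · rw [ent_self, zero_add]
    refine le_trans (le_of_eq ?_) (gap_le_two_ent hQ hP hQq)
    exact Finset.sum_congr rfl fun _ _ => add_comm _ _
  · rw [ent_self, add_zero]
    exact gap_le_two_ent hP hQ hPq

end IsTV

/-! ### Transport kernels on permutations -/

/-- `g` fixes every point outside `A`. -/
def FixesOff {V : Type*} (A : Finset V) (g : Equiv.Perm V) : Prop := ∀ v, v ∉ A → g v = v

/-- A transport kernel from `ν₁` to `ν₂`. -/
structure IsKernel {X : Type*} [Fintype X] (ν₁ ν₂ : X → ℝ) (p : X → X → ℝ) : Prop where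
  nonneg : ∀ σ τ, 0 ≤ p σ τ
  row : ∀ σ, ν₁ σ ≠ 0 → ∑ τ, p σ τ = 1
  marg : ∀ τ, ∑ σ, ν₁ σ * p σ τ = ν₂ τ

/-- Probability, under the kernel `p` started at `σ`, that the position of the label `l` in `σ`
receives another label. -/
def hit {V : Type*} [Fintype V] [DecidableEq V] (p : Equiv.Perm V → Equiv.Perm V → ℝ)
    (σ : Equiv.Perm V)
    (l : V) : ℝ :=
  ∑ τ, p σ τ * (if τ (σ⁻¹ l) = l then 0 else 1)

lemma hit_nonneg {V : Type*} [Fintype V] [DecidableEq V] {p : Equiv.Perm V → Equiv.Perm V → ℝ}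
    (hp : ∀ σ τ, 0 ≤ p σ τ) (σ : Equiv.Perm V) (l : V) : 0 ≤ hit p σ l :=
  Finset.sum_nonneg fun τ _ => mul_nonneg (hp σ τ) (by split_ifs <;> norm_num)

/-- The weighted transport inequality on the labels in `A`. -/
def TransportBound {V : Type*} [Fintype V] [DecidableEq V] (N : ℝ) (A : Finset V)
    (m : Equiv.Perm V → ℝ) : Prop :=
  ∀ ν₁ ν₂ : Equiv.Perm V → ℝ, IsPr ν₁ → IsPr ν₂ → (∀ X, m X = 0 → ν₁ X = 0) →
    (∀ X, m X = 0 → ν₂ X = 0) → (ν₁ = m ∨ ν₂ = m) → ∀ F ⊆ A, ∀ lam : V → ℝ, (∀ l, 0 ≤ lam l) →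
    ∃ p, IsKernel ν₁ ν₂ p ∧
      ∑ σ, ν₁ σ * ∑ l ∈ F, (lam l + hit p σ l) ^ 2 ≤
        2 * (N + 1) ^ 2 * (ent ν₁ m + ent ν₂ m) + (N + 1) * ∑ l ∈ F, lam l ^ 2

lemma IsTV.isKernel {X : Type*} [Fintype X] [DecidableEq X] {P Q : X → ℝ} {T : X → X → ℝ}
    (h : IsTV P Q T) :
    IsKernel P Q T := ⟨h.nonneg, fun σ _ => h.row σ, h.marg⟩

lemma IsTV.hit_le {V : Type*} [Fintype V] [DecidableEq V] {P Q : Equiv.Perm V → ℝ}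
    {T : Equiv.Perm V → Equiv.Perm V → ℝ} (h : IsTV P Q T) (σ : Equiv.Perm V) (l : V) :
    hit T σ l ≤ 1 - T σ σ := by
  have h1 : 1 - T σ σ = ∑ τ, (T σ τ - if τ = σ then T σ σ else 0) := by
    rw [Finset.sum_sub_distrib, h.row, Finset.sum_ite_eq' Finset.univ σ (fun _ => T σ σ)]
    simp
  rw [h1]
  refine Finset.sum_le_sum fun τ _ => ?_
  by_cases hτ : τ = σ
  · subst hτ; simp
  · have := h.nonneg σ τ
    rw [if_neg hτ]
    split_ifs <;> linarith

lemma transportBound_of_card_le {V : Type*} [Fintype V] [DecidableEq V] {N : ℝ} (hN : 0 < N)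
    {A : Finset V}
    {m : Equiv.Perm V → ℝ} (hA : (A.card : ℝ) ≤ N * (N + 1)) : TransportBound N A m := by
  intro ν₁ ν₂ h₁ h₂ ha₁ ha₂ hor F hF lam hlam
  obtain ⟨T, hT⟩ := exists_isTV h₁ h₂
  refine ⟨T, hT.isKernel, ?_⟩
  have hcost := hT.cost_le h₁ h₂ ha₁ ha₂ hor
  have h0 : 0 ≤ ∑ c, max (ν₂ c - ν₁ c) 0 ^ 2 / ν₂ c :=
    Finset.sum_nonneg fun c _ => div_nonneg (sq_nonneg _) (h₂.nonneg c)
  have hFc : (F.card : ℝ) ≤ N * (N + 1) :=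
    le_trans (by exact_mod_cast Finset.card_le_card hF) hA
  have key : ∀ σ, ∑ l ∈ F, (lam l + hit T σ l) ^ 2 ≤
      (N + 1) * ∑ l ∈ F, lam l ^ 2 + (N + 1) ^ 2 * (1 - T σ σ) ^ 2 := by
    intro σ
    set e := 1 - T σ σ
    have h1 : ∀ l ∈ F, (lam l + hit T σ l) ^ 2 ≤ (N + 1) * lam l ^ 2 + (N + 1) / N * e ^ 2 := by
      intro l _
      have h2 : (lam l + hit T σ l) ^ 2 ≤ (lam l + e) ^ 2 :=
        pow_le_pow_left₀ (add_nonneg (hlam l) (hit_nonneg hT.nonneg σ l))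
          (by linarith [hT.hit_le σ l]) 2
      refine h2.trans ?_
      have : (N + 1) * lam l ^ 2 + (N + 1) / N * e ^ 2 - (lam l + e) ^ 2 =
          (N * lam l - e) ^ 2 / N := by field_simp; ring
      have h3 : 0 ≤ (N * lam l - e) ^ 2 / N := by positivity
      linarith
    refine (Finset.sum_le_sum h1).trans ?_
    rw [Finset.sum_add_distrib, ← Finset.mul_sum, Finset.sum_const, nsmul_eq_mul]
    have : (F.card : ℝ) * ((N + 1) / N * e ^ 2) ≤ N * (N + 1) * ((N + 1) / N * e ^ 2) :=
      mul_le_mul_of_nonneg_right hFc (by positivity)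
    have h4 : N * (N + 1) * ((N + 1) / N * e ^ 2) = (N + 1) ^ 2 * e ^ 2 := by field_simp
    linarith
  calc ∑ σ, ν₁ σ * ∑ l ∈ F, (lam l + hit T σ l) ^ 2
      ≤ ∑ σ, ν₁ σ * ((N + 1) * ∑ l ∈ F, lam l ^ 2 + (N + 1) ^ 2 * (1 - T σ σ) ^ 2) :=
        Finset.sum_le_sum fun σ _ => mul_le_mul_of_nonneg_left (key σ) (h₁.nonneg σ)
    _ = (N + 1) * ∑ l ∈ F, lam l ^ 2 + (N + 1) ^ 2 * ∑ σ, ν₁ σ * (1 - T σ σ) ^ 2 := by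
        simp only [mul_add, Finset.sum_add_distrib]
        rw [← Finset.sum_mul, h₁.sum_one, one_mul, Finset.mul_sum (a := (N + 1) ^ 2)]
        congr 1
        exact Finset.sum_congr rfl fun σ _ => by ring
    _ ≤ _ := by nlinarith [sq_nonneg (N + 1)]

/-! ### Splitting a measure along the image of one point -/

/-- `m` is the law of `u i * ρ` where `i` has law `q` and `ρ`, with law `m'`, is independent of `i`
and fixes `x`. -/
structure Split {V : Type*} [Fintype V] [DecidableEq V] (A : Finset V) (m : Equiv.Perm V → ℝ)
    (x : V) (q : V → ℝ)
    (m' : Equiv.Perm V → ℝ) (u : V → Equiv.Perm V) : Prop where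
  q_pr : IsPr q
  q_off : ∀ i, i ∉ A → q i = 0
  m'_pr : IsPr m'
  m'_off : ∀ ρ, m' ρ ≠ 0 → FixesOff (A.erase x) ρ
  u_base : ∀ i, u i x = i
  u_off : ∀ i ∈ A, FixesOff A (u i)
  eq : ∀ X, m X = q (X x) * m' ((u (X x))⁻¹ * X)

/-- Law of the image of `x`. -/
def mg {V : Type*} [Fintype V] [DecidableEq V] (x : V) (ν : Equiv.Perm V → ℝ) (i : V) : ℝ :=
  ∑ σ : Equiv.Perm V, if σ x = i then ν σ else 0

/-- Conditional law of `(u i)⁻¹ * σ` given `σ x = i`. -/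
def condLaw {V : Type*} [Fintype V] [DecidableEq V] (x : V) (u : V → Equiv.Perm V)
    (ν : Equiv.Perm V → ℝ) (i : V)
    (ρ : Equiv.Perm V) : ℝ :=
  if ρ x = x then ν (u i * ρ) / mg x ν i else 0

section Splitting

variable {V : Type*} [Fintype V] [DecidableEq V] {x : V} {u : V → Equiv.Perm V}

lemma sum_perm_eq_image (hu : ∀ i, u i x = i) (i : V) (f : Equiv.Perm V → ℝ) :
    ∑ σ : Equiv.Perm V, (if σ x = i then f σ else 0) =
      ∑ ρ : Equiv.Perm V, if ρ x = x then f (u i * ρ) else 0 := by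
  rw [← Equiv.sum_comp (Equiv.mulLeft (u i))]
  refine Finset.sum_congr rfl fun ρ _ => ?_
  have : (u i * ρ) x = i ↔ ρ x = x := by
    rw [Equiv.Perm.mul_apply, ← (u i).injective.eq_iff (a := ρ x), hu i]
  simp only [Equiv.coe_mulLeft, this]

lemma sum_perm_split (hu : ∀ i, u i x = i) (f : Equiv.Perm V → ℝ) :
    ∑ σ, f σ = ∑ i, ∑ ρ : Equiv.Perm V, if ρ x = x then f (u i * ρ) else 0 := by
  simp only [← sum_perm_eq_image hu]
  rw [Finset.sum_comm]
  simp

lemma mg_pr {ν : Equiv.Perm V → ℝ} (h : IsPr ν) : IsPr (mg x ν) := by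
  refine ⟨fun i => Finset.sum_nonneg fun σ _ => ?_, ?_⟩
  · split_ifs
    exacts [h.nonneg σ, le_rfl]
  · rw [← h.sum_one]
    unfold mg
    rw [Finset.sum_comm]
    simp

lemma le_mg {ν : Equiv.Perm V → ℝ} (h : IsPr ν) (σ : Equiv.Perm V) : ν σ ≤ mg x ν (σ x) := by
  refine le_trans (le_of_eq (by simp)) (Finset.single_le_sum
    (f := fun τ : Equiv.Perm V => if τ x = σ x then ν τ else 0) (fun τ _ => ?_)
    (Finset.mem_univ σ))
  split_ifs
  exacts [h.nonneg τ, le_rfl]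

lemma mg_ne_zero {ν : Equiv.Perm V → ℝ} (h : IsPr ν) {σ : Equiv.Perm V} (hσ : ν σ ≠ 0) :
    mg x ν (σ x) ≠ 0 :=
  (((h.nonneg σ).lt_of_ne' hσ).trans_le (le_mg h σ)).ne'

lemma mg_mul_condLaw (hu : ∀ i, u i x = i) {ν : Equiv.Perm V → ℝ} (h : IsPr ν) (i : V)
    (ρ : Equiv.Perm V) :
    mg x ν i * condLaw x u ν i ρ = if ρ x = x then ν (u i * ρ) else 0 := by
  unfold condLaw
  split_ifs with hρ
  · by_cases h0 : mg x ν i = 0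
    · rw [h0, zero_mul]
      by_contra hne
      have := mg_ne_zero (x := x) h (Ne.symm hne)
      rw [Equiv.Perm.mul_apply, hρ, hu] at this
      exact this h0
    · field_simp
  · rw [mul_zero]

lemma sum_mul_split (hu : ∀ i, u i x = i) {ν : Equiv.Perm V → ℝ} (h : IsPr ν)
    (f : Equiv.Perm V → ℝ) :
    ∑ σ, ν σ * f σ = ∑ i, mg x ν i * ∑ ρ, condLaw x u ν i ρ * f (u i * ρ) := by
  rw [sum_perm_split hu]
  refine Finset.sum_congr rfl fun i _ => ?_
  rw [Finset.mul_sum]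
  refine Finset.sum_congr rfl fun ρ _ => ?_
  rw [← mul_assoc, mg_mul_condLaw hu h]
  split_ifs <;> simp

lemma condLaw_pr (hu : ∀ i, u i x = i) {ν : Equiv.Perm V → ℝ} (h : IsPr ν) {i : V}
    (hi : mg x ν i ≠ 0) : IsPr (condLaw x u ν i) := by
  refine ⟨fun ρ => ?_, ?_⟩
  · unfold condLaw
    split_ifs
    exacts [div_nonneg (h.nonneg _) ((mg_pr h).nonneg i), le_rfl]
  · refine mul_left_cancel₀ hi ?_
    rw [Finset.mul_sum, mul_one]
    simp only [mg_mul_condLaw hu h]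
    rw [← sum_perm_eq_image hu]
    rfl

lemma sum_mg_mul {ν : Equiv.Perm V → ℝ} (f : V → ℝ) :
    ∑ σ, ν σ * f (σ x) = ∑ i, mg x ν i * f i := by
  unfold mg
  simp only [Finset.sum_mul]
  rw [Finset.sum_comm]
  simp [ite_mul]

namespace Split

variable {A : Finset V} {m m' : Equiv.Perm V → ℝ} {q : V → ℝ}

lemma apply_mul (h : Split A m x q m' u) {i : V} {ρ : Equiv.Perm V} (hρ : ρ x = x) :
    m (u i * ρ) = q i * m' ρ := by
  rw [h.eq, Equiv.Perm.mul_apply, hρ, h.u_base, inv_mul_cancel_left]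

lemma m'_apply (h : Split A m x q m' u) {ρ : Equiv.Perm V} (hρ : ρ x ≠ x) : m' ρ = 0 := by
  by_contra h0
  exact hρ (h.m'_off ρ h0 x (by simp))

lemma mg_eq (h : Split A m x q m' u) (i : V) : mg x m i = q i := by
  unfold mg
  rw [sum_perm_eq_image h.u_base, ← mul_one (q i), ← h.m'_pr.sum_one, Finset.mul_sum]
  refine Finset.sum_congr rfl fun ρ _ => ?_
  split_ifs with hρ
  · exact h.apply_mul hρ
  · rw [h.m'_apply hρ, mul_zero]

lemma condLaw_eq (h : Split A m x q m' u) {i : V} (hi : q i ≠ 0) : condLaw x u m i = m' := by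
  funext ρ
  unfold condLaw
  split_ifs with hρ
  · rw [h.apply_mul hρ, h.mg_eq]; field_simp
  · exact (h.m'_apply hρ).symm

variable {ν : Equiv.Perm V → ℝ}

lemma mg_ac (h : Split A m x q m' u) (hν : ∀ X, m X = 0 → ν X = 0) (i : V) (hi : q i = 0) :
    mg x ν i = 0 := by
  refine Finset.sum_eq_zero fun σ _ => ?_
  split_ifs with hσ
  · apply hν; rw [h.eq, hσ, hi, zero_mul]
  · rfl

lemma condLaw_ac (h : Split A m x q m' u) (hν : ∀ X, m X = 0 → ν X = 0) (i : V)
    (ρ : Equiv.Perm V) (hρ : m' ρ = 0) : condLaw x u ν i ρ = 0 := by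
  unfold condLaw
  split_ifs with hx
  · rw [hν _ (by rw [h.apply_mul hx, hρ, mul_zero]), zero_div]
  · rfl

lemma ent_eq (h : Split A m x q m' u) (hν : IsPr ν) (hac : ∀ X, m X = 0 → ν X = 0) :
    ent ν m = ent (mg x ν) q + ∑ i, mg x ν i * ent (condLaw x u ν i) m' := by
  have h1 : ent ν m = ∑ σ, ν σ * Real.log (ν σ / m σ) := rfl
  rw [h1, sum_mul_split h.u_base hν, ent, ← Finset.sum_add_distrib]
  refine Finset.sum_congr rfl fun i _ => ?_
  by_cases hi : mg x ν i = 0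
  · rw [hi]; ring
  have hp := condLaw_pr h.u_base hν hi
  rw [← mul_add]
  congr 1
  rw [← one_mul (Real.log _), ← hp.sum_one, Finset.sum_mul, ent, ← Finset.sum_add_distrib]
  refine Finset.sum_congr rfl fun ρ _ => ?_
  by_cases hρ : condLaw x u ν i ρ = 0
  · rw [hρ]; ring
  rw [← mul_add]
  congr 1
  have hx : ρ x = x := by
    by_contra hx
    exact hρ (by simp [condLaw, hx])
  have hm' : m' ρ ≠ 0 := fun h0 => hρ (h.condLaw_ac hac i ρ h0)
  have hq : q i ≠ 0 := fun h0 => hi (h.mg_ac hac i h0)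
  have hνe : ν (u i * ρ) = mg x ν i * condLaw x u ν i ρ := by
    rw [mg_mul_condLaw h.u_base hν, if_pos hx]
  rw [hνe, h.apply_mul hx, mul_div_mul_comm, Real.log_mul (div_ne_zero hi hq)
    (div_ne_zero hρ hm')]

end Split

end Splitting

/-! ### One step of the recursion -/

section Step

variable {V : Type*} [Fintype V] [DecidableEq V] {N : ℝ} {A : Finset V} {x : V} {q : V → ℝ}
  {m m' : Equiv.Perm V → ℝ} {u : V → Equiv.Perm V} {ν₁ ν₂ : Equiv.Perm V → ℝ}
  {T : V → V → ℝ} {K : V → V → Equiv.Perm V → Equiv.Perm V → ℝ}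

lemma condLaw_base_ne {ν : Equiv.Perm V → ℝ} {i : V} {ρ : Equiv.Perm V} (hρ : ρ x ≠ x) :
    condLaw x u ν i ρ = 0 := by simp [condLaw, hρ]

lemma Split.exists_inner (h : Split A m x q m' u) (IH : TransportBound N (A.erase x) m')
    (h₁ : IsPr ν₁) (h₂ : IsPr ν₂) (ha₁ : ∀ X, m X = 0 → ν₁ X = 0) (ha₂ : ∀ X, m X = 0 → ν₂ X = 0)
    (hor : ν₁ = m ∨ ν₂ = m) {F : Finset V} (hF : F ⊆ A) {lam : V → ℝ} (hlam : ∀ l, 0 ≤ lam l)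
    (hT : ∀ i c, 0 ≤ T i c) {i c : V} (hi : mg x ν₁ i ≠ 0) (hc : mg x ν₂ c ≠ 0) :
    ∃ k, IsKernel (condLaw x u ν₁ i) (condLaw x u ν₂ c) k ∧
      ∑ ρ, condLaw x u ν₁ i ρ * ∑ l ∈ (F.erase i).erase c,
        (lam l + T i l + hit k ρ ((u i)⁻¹ l)) ^ 2 ≤
      2 * (N + 1) ^ 2 * (ent (condLaw x u ν₁ i) m' + ent (condLaw x u ν₂ c) m') +
        (N + 1) * ∑ l ∈ (F.erase i).erase c, (lam l + T i l) ^ 2 := by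
  have hqi : q i ≠ 0 := fun h0 => hi (h.mg_ac ha₁ i h0)
  have hqc : q c ≠ 0 := fun h0 => hc (h.mg_ac ha₂ c h0)
  have hiA : i ∈ A := by
    by_contra h0
    exact hqi (h.q_off i h0)
  have hinj : ∀ s : Finset V, Set.InjOn (fun l => (u i)⁻¹ l) s :=
    fun s a _ b _ hab => (u i)⁻¹.injective hab
  obtain ⟨k, hk, hb⟩ := IH (condLaw x u ν₁ i) (condLaw x u ν₂ c) (condLaw_pr h.u_base h₁ hi)
    (condLaw_pr h.u_base h₂ hc) (h.condLaw_ac ha₁ i) (h.condLaw_ac ha₂ c)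
    (by
      rcases hor with rfl | rfl
      · exact Or.inl (h.condLaw_eq hqi)
      · exact Or.inr (h.condLaw_eq hqc))
    (((F.erase i).erase c).image fun l => (u i)⁻¹ l)
    (by
      intro l' hl'
      obtain ⟨l, hl, rfl⟩ := Finset.mem_image.1 hl'
      simp only [Finset.mem_erase] at hl
      refine Finset.mem_erase.2 ⟨fun h0 => hl.2.1 ?_, ?_⟩
      · rw [← h.u_base i, ← h0]; simp
      · by_contra h0
        have := h.u_off i hiA _ h0
        rw [Equiv.Perm.inv_def, Equiv.apply_symm_apply] at this
        rw [Equiv.Perm.inv_def, ← this] at h0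
        exact h0 (hF hl.2.2))
    (fun l' => lam (u i l') + T i (u i l')) (fun l' => add_nonneg (hlam _) (hT _ _))
  refine ⟨k, hk, ?_⟩
  simp only [Finset.sum_image (hinj _)] at hb
  simpa using hb

/-- Kernel obtained by moving the image of `x` with `T` and the remaining part with `K`. -/
def glue (x : V) (u : V → Equiv.Perm V) (T : V → V → ℝ)
    (K : V → V → Equiv.Perm V → Equiv.Perm V → ℝ) (σ τ : Equiv.Perm V) : ℝ :=
  T (σ x) (τ x) * K (σ x) (τ x) ((u (σ x))⁻¹ * σ) ((u (τ x))⁻¹ * τ)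

lemma IsTV.mg_right_ne_zero (hT : IsTV (mg x ν₁) (mg x ν₂) T) (h₁ : IsPr ν₁) {i c : V}
    (hi : mg x ν₁ i ≠ 0) (hc : T i c ≠ 0) : mg x ν₂ c ≠ 0 := by
  rw [← hT.marg]
  have h0 : ∀ j, 0 ≤ mg x ν₁ j * T j c := fun j => mul_nonneg ((mg_pr h₁).nonneg j) (hT.nonneg j c)
  have := Finset.single_le_sum (f := fun j => mg x ν₁ j * T j c) (fun j _ => h0 j)
    (Finset.mem_univ i)
  exact (((h0 i).lt_of_ne' (mul_ne_zero hi hc)).trans_le this).ne'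

lemma IsKernel.eq_zero {X : Type*} [Fintype X] {P Q : X → ℝ} {k : X → X → ℝ} (hk : IsKernel P Q k)
    (hP : ∀ a, 0 ≤ P a) {a b : X} (ha : P a ≠ 0) (hb : Q b = 0) : k a b = 0 := by
  have := (Finset.sum_eq_zero_iff_of_nonneg (f := fun a => P a * k a b)
    (fun a _ => mul_nonneg (hP a) (hk.nonneg a b))).1 ((hk.marg b).trans hb) a (Finset.mem_univ a)
  exact (mul_eq_zero.1 this).resolve_left ha

section Glue

variable (hu : ∀ i, u i x = i) (h₁ : IsPr ν₁) (h₂ : IsPr ν₂) (hT : IsTV (mg x ν₁) (mg x ν₂) T)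
  (hK0 : ∀ i c ρ ρ', 0 ≤ K i c ρ ρ')
  (hK : ∀ i c, mg x ν₁ i ≠ 0 → mg x ν₂ c ≠ 0 →
    IsKernel (condLaw x u ν₁ i) (condLaw x u ν₂ c) (K i c))

include hu h₁

lemma condLaw_ne_zero {σ : Equiv.Perm V} (hσ : ν₁ σ ≠ 0) :
    condLaw x u ν₁ (σ x) ((u (σ x))⁻¹ * σ) ≠ 0 := by
  intro h0
  have := mg_mul_condLaw hu h₁ (σ x) ((u (σ x))⁻¹ * σ)
  rw [h0, mul_zero, mul_inv_cancel_left, if_pos] at this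
  · exact hσ this.symm
  · rw [Equiv.Perm.mul_apply, Equiv.Perm.inv_eq_iff_eq, hu]

include hT hK

lemma sum_glue_mul {σ : Equiv.Perm V} (hσ : ν₁ σ ≠ 0) (f : Equiv.Perm V → ℝ) :
    ∑ τ, glue x u T K σ τ * f τ =
      ∑ c, T (σ x) c * ∑ ρ, K (σ x) c ((u (σ x))⁻¹ * σ) ρ * f (u c * ρ) := by
  rw [sum_perm_split hu]
  refine Finset.sum_congr rfl fun c _ => ?_
  rw [Finset.mul_sum]
  refine Finset.sum_congr rfl fun ρ _ => ?_
  have hi := mg_ne_zero (x := x) h₁ hσ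
  split_ifs with hρ
  · unfold glue
    rw [Equiv.Perm.mul_apply (u c), hρ, hu, inv_mul_cancel_left]
    ring
  · by_cases hTc : T (σ x) c = 0
    · rw [hTc, zero_mul]
    · have hc := hT.mg_right_ne_zero h₁ hi hTc
      rw [(hK _ _ hi hc).eq_zero (condLaw_pr hu h₁ hi).nonneg (condLaw_ne_zero hu h₁ hσ)
        (condLaw_base_ne hρ)]
      ring

lemma sum_glue_row {σ : Equiv.Perm V} (hσ : ν₁ σ ≠ 0) {c : V} (hc : T (σ x) c ≠ 0) :
    ∑ ρ, K (σ x) c ((u (σ x))⁻¹ * σ) ρ = 1 :=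
  have hi := mg_ne_zero (x := x) h₁ hσ
  (hK _ _ hi (hT.mg_right_ne_zero h₁ hi hc)).row _ (condLaw_ne_zero hu h₁ hσ)

include h₂ hK0

lemma isKernel_glue : IsKernel ν₁ ν₂ (glue x u T K) := by
  refine ⟨fun σ τ => mul_nonneg (hT.nonneg _ _) (hK0 _ _ _ _), fun σ hσ => ?_, fun τ => ?_⟩
  · have := sum_glue_mul hu h₁ hT hK hσ (fun _ => 1)
    simp only [mul_one] at this
    rw [this, ← hT.row (σ x)]
    refine Finset.sum_congr rfl fun c _ => ?_
    by_cases hc : T (σ x) c = 0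
    · rw [hc, zero_mul]
    · rw [sum_glue_row hu h₁ hT hK hσ hc, mul_one]
  · rw [sum_mul_split hu h₁]
    set c := τ x with hcdef
    have hρ' : ((u c)⁻¹ * τ) x = x := by
      rw [Equiv.Perm.mul_apply, Equiv.Perm.inv_eq_iff_eq, hu]
    have key : ∀ i, mg x ν₁ i * ∑ ρ, condLaw x u ν₁ i ρ * glue x u T K (u i * ρ) τ =
        mg x ν₁ i * T i c * condLaw x u ν₂ c ((u c)⁻¹ * τ) := by
      intro i
      by_cases hz : mg x ν₁ i * T i c = 0
      · rw [hz, zero_mul, Finset.mul_sum]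
        refine Finset.sum_eq_zero fun ρ _ => ?_
        by_cases hρ : ρ x = x
        · unfold glue
          rw [Equiv.Perm.mul_apply (u i), hρ, hu]
          calc _ = (mg x ν₁ i * T i c) * (condLaw x u ν₁ i ρ * K i c ((u i)⁻¹ * (u i * ρ))
                ((u c)⁻¹ * τ)) := by ring
            _ = 0 := by rw [hz, zero_mul]
        · rw [condLaw_base_ne hρ]; ring
      · have hi : mg x ν₁ i ≠ 0 := left_ne_zero_of_mul hz
        have hc := hT.mg_right_ne_zero h₁ hi (right_ne_zero_of_mul hz)
        rw [← (hK i c hi hc).marg, Finset.mul_sum, Finset.mul_sum]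
        refine Finset.sum_congr rfl fun ρ _ => ?_
        by_cases hρ : ρ x = x
        · unfold glue
          rw [Equiv.Perm.mul_apply (u i), hρ, hu, inv_mul_cancel_left]
          ring
        · rw [condLaw_base_ne hρ]; ring
    rw [Finset.sum_congr rfl fun i _ => key i, ← Finset.sum_mul, hT.marg,
      mg_mul_condLaw hu h₂, if_pos hρ', mul_inv_cancel_left]

omit h₂ hK0 in
lemma hit_glue_base_le {σ : Equiv.Perm V} (hσ : ν₁ σ ≠ 0) :
    hit (glue x u T K) σ (σ x) ≤ 1 - T (σ x) (σ x) := by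
  unfold hit
  rw [sum_glue_mul hu h₁ hT hK hσ, ← hT.off_row,
    ← Finset.add_sum_erase Finset.univ _ (Finset.mem_univ (σ x))]
  have h0 : ∀ c, T (σ x) c * ∑ ρ : Equiv.Perm V, K (σ x) c ((u (σ x))⁻¹ * σ) ρ *
      (if (u c * ρ) (σ⁻¹ (σ x)) = σ x then 0 else 1) = if c = σ x then 0 else T (σ x) c := by
    intro c
    by_cases hTc : T (σ x) c = 0
    · rw [hTc]; simp
    have hi := mg_ne_zero (x := x) h₁ hσ
    have hc := hT.mg_right_ne_zero h₁ hi hTc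
    have h2 : ∀ ρ : Equiv.Perm V, K (σ x) c ((u (σ x))⁻¹ * σ) ρ *
        (if (u c * ρ) (σ⁻¹ (σ x)) = σ x then 0 else 1) =
        K (σ x) c ((u (σ x))⁻¹ * σ) ρ * (if c = σ x then 0 else 1) := by
      intro ρ
      by_cases hρ : ρ x = x
      · rw [Equiv.Perm.mul_apply, show σ⁻¹ (σ x) = x by simp, hρ, hu]
      · rw [(hK _ _ hi hc).eq_zero (condLaw_pr hu h₁ hi).nonneg (condLaw_ne_zero hu h₁ hσ)
          (condLaw_base_ne hρ)]
        ring
    rw [Finset.sum_congr rfl fun ρ _ => h2 ρ, ← Finset.sum_mul, sum_glue_row hu h₁ hT hK hσ hTc]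
    split_ifs <;> simp
  simp only [h0, if_true, zero_add]
  refine Finset.sum_le_sum fun c hc => ?_
  rw [if_neg (Finset.ne_of_mem_erase hc)]

omit h₂ in
lemma hit_glue_le {σ : Equiv.Perm V} (hσ : ν₁ σ ≠ 0) (l : V) :
    hit (glue x u T K) σ l ≤ T (σ x) l + ∑ c, T (σ x) c *
      ((if c = l then 0 else hit (K (σ x) c) ((u (σ x))⁻¹ * σ) ((u (σ x))⁻¹ l)) +
        if c = l then 0 else if u c ((u (σ x))⁻¹ l) = l then 0 else 1) := by
  set i := σ x with hi
  set ρ := (u i)⁻¹ * σ with hρ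
  have hl : T i l = ∑ c, T i c * (if c = l then 1 else 0) := by simp
  unfold hit
  rw [sum_glue_mul hu h₁ hT hK hσ, hl, ← Finset.sum_add_distrib]
  refine Finset.sum_le_sum fun c _ => ?_
  by_cases hTc : T i c = 0
  · rw [← hi, hTc]; simp
  rw [← mul_add]
  refine mul_le_mul_of_nonneg_left ?_ (hT.nonneg _ _)
  have hrow := sum_glue_row hu h₁ hT hK hσ hTc
  by_cases hcl : c = l
  · simp only [hcl, if_true, add_zero]
    refine le_trans (Finset.sum_le_sum (g := fun ρ' => K i c ρ ρ') fun ρ' _ => ?_) hrow.le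
    have := hK0 i c ((u i)⁻¹ * σ) ρ'
    rw [← hcl]
    split_ifs <;> linarith
  · simp only [hcl, if_false, zero_add]
    have h3 : (if u c ((u i)⁻¹ l) = l then (0 : ℝ) else 1) =
        ∑ ρ', K i c ρ ρ' * (if u c ((u i)⁻¹ l) = l then (0 : ℝ) else 1) := by
      rw [← Finset.sum_mul, hrow, one_mul]
    rw [h3, ← Finset.sum_add_distrib]
    refine Finset.sum_le_sum fun ρ' _ => ?_
    rw [← mul_add]
    refine mul_le_mul_of_nonneg_left ?_ (hK0 _ _ _ _)
    have h4 : ρ⁻¹ ((u i)⁻¹ l) = σ⁻¹ l := by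
      rw [hρ]; simp
    rw [h4]
    by_cases ha : ρ' (σ⁻¹ l) = (u i)⁻¹ l
    · rw [Equiv.Perm.mul_apply, ha]; simp
    · rw [if_neg ha]; split_ifs <;> norm_num

end Glue

end Step

section StepBound

variable {V : Type*} [Fintype V] [DecidableEq V] {N : ℝ} {A : Finset V} {x : V} {q : V → ℝ}
  {m m' : Equiv.Perm V → ℝ} {u : V → Equiv.Perm V} {ν₁ ν₂ : Equiv.Perm V → ℝ}
  {T : V → V → ℝ}

/-- Error term produced by one step of the recursion. -/
def stepResidual (N : ℝ) (P Q : V → ℝ) (T : V → V → ℝ) (F : Finset V) (lam : V → ℝ) : ℝ :=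
  ∑ i, (-(N + 1) * (P i * (if i ∈ F then lam i else 0) ^ 2) + (N + 1) * (P i * (1 - T i i) ^ 2) +
    2 * (N + 1) * ((if i ∈ F then lam i else 0) * max (Q i - P i) 0) -
    N * ((if i ∈ F then lam i else 0) ^ 2 * max (Q i - P i) 0))

/-- Summing the weights `lam l + T i l` over a total variation coupling. -/
lemma IsTV.sum_weights_le (hN : 0 ≤ N) {P Q : V → ℝ} (hP : IsPr P) (hT : IsTV P Q T) (F : Finset V)
    (lam : V → ℝ) :
    ∑ i, P i * ∑ c, T i c * ((N + 1) * ∑ l ∈ F.erase i, (lam l + T i l) ^ 2 -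
        if c ∈ F ∧ c ≠ i then N * lam c ^ 2 else 0) ≤
      (N + 1) * ∑ l ∈ F, lam l ^ 2 + stepResidual N P Q T F lam := by
  unfold stepResidual
  set θ : V → ℝ := fun i => if i ∈ F then lam i else 0 with hθ
  set S := ∑ l ∈ F, lam l ^ 2 with hS
  have hoff : ∀ w : V → ℝ, ∑ i, P i * ∑ c, T i c * (if c = i then 0 else w c) =
      ∑ c, w c * max (Q c - P c) 0 := by
    intro w
    simp only [← hT.off, Finset.mul_sum]
    rw [Finset.sum_comm]
    refine Finset.sum_congr rfl fun c _ => Finset.sum_congr rfl fun i _ => ?_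
    by_cases h : i = c
    · simp [h]
    · simp only [h, Ne.symm h, if_false]; ring
  have hsF : ∀ w : V → ℝ, ∀ i, ∑ l ∈ F.erase i, w l =
      ∑ l, if l = i then 0 else if l ∈ F then w l else 0 := by
    intro w i
    rw [← Finset.univ_inter (F.erase i), ← Finset.sum_ite_mem Finset.univ]
    refine Finset.sum_congr rfl fun l _ => ?_
    by_cases h1 : l = i <;> by_cases h2 : l ∈ F <;> simp [h1, h2]
  have hrow : ∀ i, ∑ c, T i c * ((N + 1) * ∑ l ∈ F.erase i, (lam l + T i l) ^ 2 -
      if c ∈ F ∧ c ≠ i then N * lam c ^ 2 else 0) ≤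
      (N + 1) * (S - θ i ^ 2 + (1 - T i i) ^ 2) +
        2 * (N + 1) * ∑ c, T i c * (if c = i then 0 else θ c) -
        N * ∑ c, T i c * (if c = i then 0 else θ c ^ 2) := by
    intro i
    have e1 : ∑ c, T i c * ((N + 1) * ∑ l ∈ F.erase i, (lam l + T i l) ^ 2 -
        if c ∈ F ∧ c ≠ i then N * lam c ^ 2 else 0) =
        (N + 1) * ∑ l ∈ F.erase i, (lam l + T i l) ^ 2 -
          N * ∑ c, T i c * (if c = i then 0 else θ c ^ 2) := by
      simp only [mul_sub, Finset.sum_sub_distrib]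
      rw [← Finset.sum_mul, hT.row, one_mul, Finset.mul_sum (a := N)]
      congr 1
      refine Finset.sum_congr rfl fun c _ => ?_
      by_cases h1 : c = i <;> by_cases h2 : c ∈ F <;> simp [h1, h2, hθ]
      ring
    have e2 : ∑ l ∈ F.erase i, (lam l + T i l) ^ 2 = ∑ l ∈ F.erase i, lam l ^ 2 +
        2 * ∑ l ∈ F.erase i, T i l * lam l + ∑ l ∈ F.erase i, T i l ^ 2 := by
      rw [Finset.mul_sum, ← Finset.sum_add_distrib, ← Finset.sum_add_distrib]
      exact Finset.sum_congr rfl fun l _ => by ring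
    have e3 : ∑ l ∈ F.erase i, lam l ^ 2 = ∑ l ∈ F, lam l ^ 2 - θ i ^ 2 := by
      by_cases h : i ∈ F
      · rw [← Finset.add_sum_erase F _ h]; simp [hθ, h]
      · rw [Finset.erase_eq_of_notMem h]; simp [hθ, h]
    have e4 : ∑ l ∈ F.erase i, T i l * lam l = ∑ c, T i c * (if c = i then 0 else θ c) := by
      rw [hsF]
      refine Finset.sum_congr rfl fun c _ => ?_
      by_cases h1 : c = i <;> by_cases h2 : c ∈ F <;> simp [h1, h2, hθ]
    have e5 : ∑ l ∈ F.erase i, T i l ^ 2 ≤ (1 - T i i) ^ 2 := by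
      calc ∑ l ∈ F.erase i, T i l ^ 2 ≤ ∑ l ∈ Finset.univ.erase i, T i l ^ 2 :=
            Finset.sum_le_sum_of_subset_of_nonneg (Finset.erase_subset_erase _ (Finset.subset_univ _))
              fun _ _ _ => sq_nonneg _
        _ ≤ ∑ l ∈ Finset.univ.erase i, T i l * (1 - T i i) := by
            refine Finset.sum_le_sum fun l hl => ?_
            rw [sq]
            exact mul_le_mul_of_nonneg_left (hT.le_off (Finset.ne_of_mem_erase hl)) (hT.nonneg _ _)
        _ = _ := by rw [← Finset.sum_mul, hT.off_row, sq]
    rw [e1, e2, e3, e4]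
    have := mul_le_mul_of_nonneg_left e5 (show 0 ≤ N + 1 by linarith)
    linarith
  clear_value S
  refine (Finset.sum_le_sum fun i _ => mul_le_mul_of_nonneg_left (hrow i) (hP.nonneg i)).trans ?_
  have e6 : ∑ i, P i * ((N + 1) * (S - θ i ^ 2 + (1 - T i i) ^ 2) +
        2 * (N + 1) * ∑ c, T i c * (if c = i then 0 else θ c) -
        N * ∑ c, T i c * (if c = i then 0 else θ c ^ 2)) =
      (N + 1) * S * ∑ i, P i + ∑ i, (-(N + 1) * (P i * θ i ^ 2) +
        (N + 1) * (P i * (1 - T i i) ^ 2)) + 2 * (N + 1) *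
        ∑ i, P i * ∑ c, T i c * (if c = i then 0 else θ c) -
        N * ∑ i, P i * ∑ c, T i c * (if c = i then 0 else θ c ^ 2) := by
    rw [Finset.mul_sum, Finset.mul_sum, Finset.mul_sum, ← Finset.sum_add_distrib,
      ← Finset.sum_add_distrib, ← Finset.sum_sub_distrib]
    exact Finset.sum_congr rfl fun i _ => by ring
  rw [e6, hoff, hoff, hP.sum_one, mul_one, Finset.mul_sum, Finset.mul_sum (a := N), add_assoc,
    add_sub_assoc, ← Finset.sum_add_distrib, ← Finset.sum_sub_distrib]

lemma Split.exists_step (hN : 0 ≤ N) (h : Split A m x q m' u)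
    (IH : TransportBound N (A.erase x) m')
    (h₁ : IsPr ν₁) (h₂ : IsPr ν₂) (ha₁ : ∀ X, m X = 0 → ν₁ X = 0) (ha₂ : ∀ X, m X = 0 → ν₂ X = 0)
    (hor : ν₁ = m ∨ ν₂ = m) {F : Finset V} (hF : F ⊆ A) {lam : V → ℝ} (hlam : ∀ l, 0 ≤ lam l)
    (hT : IsTV (mg x ν₁) (mg x ν₂) T) :
    ∃ (p : Equiv.Perm V → Equiv.Perm V → ℝ) (Y : Equiv.Perm V → V → V → ℝ),
      IsKernel ν₁ ν₂ p ∧ (∀ σ c l, 0 ≤ Y σ c l) ∧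
      (∀ σ, ν₁ σ ≠ 0 → hit p σ (σ x) ≤ 1 - T (σ x) (σ x)) ∧
      (∀ σ, ν₁ σ ≠ 0 → ∀ l, hit p σ l ≤ T (σ x) l + ∑ c, T (σ x) c * (Y σ c l +
        if c = l then 0 else if u c ((u (σ x))⁻¹ l) = l then 0 else 1)) ∧
      ∑ σ, ν₁ σ * ∑ c, T (σ x) c * ∑ l ∈ F.erase (σ x), (lam l + T (σ x) l + Y σ c l) ^ 2 ≤
        2 * (N + 1) ^ 2 * (ent ν₁ m + ent ν₂ m - ent (mg x ν₁) q - ent (mg x ν₂) q) +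
        ((N + 1) * ∑ l ∈ F, lam l ^ 2 + stepResidual N (mg x ν₁) (mg x ν₂) T F lam) := by
  have hin : ∀ i c, ∃ k : Equiv.Perm V → Equiv.Perm V → ℝ, (∀ ρ ρ', 0 ≤ k ρ ρ') ∧
      (mg x ν₁ i ≠ 0 → mg x ν₂ c ≠ 0 → IsKernel (condLaw x u ν₁ i) (condLaw x u ν₂ c) k ∧
      ∑ ρ, condLaw x u ν₁ i ρ * ∑ l ∈ (F.erase i).erase c,
        (lam l + T i l + hit k ρ ((u i)⁻¹ l)) ^ 2 ≤
      2 * (N + 1) ^ 2 * (ent (condLaw x u ν₁ i) m' + ent (condLaw x u ν₂ c) m') +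
        (N + 1) * ∑ l ∈ (F.erase i).erase c, (lam l + T i l) ^ 2) := by
    intro i c
    by_cases hi : mg x ν₁ i = 0
    · exact ⟨fun _ _ => 0, fun _ _ => le_rfl, fun h0 => absurd hi h0⟩
    by_cases hc : mg x ν₂ c = 0
    · exact ⟨fun _ _ => 0, fun _ _ => le_rfl, fun _ h0 => absurd hc h0⟩
    obtain ⟨k, hk, hb⟩ := h.exists_inner IH h₁ h₂ ha₁ ha₂ hor hF hlam hT.nonneg hi hc
    exact ⟨k, hk.nonneg, fun _ _ => ⟨hk, hb⟩⟩
  choose K hK0 hK using hin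
  have hKk := fun i c hi hc => (hK i c hi hc).1
  have hu := h.u_base
  refine ⟨glue x u T K, fun σ c l => if c = l then 0 else
    hit (K (σ x) c) ((u (σ x))⁻¹ * σ) ((u (σ x))⁻¹ l), isKernel_glue hu h₁ h₂ hT hK0 hKk,
    fun σ c l => ?_, fun σ hσ => hit_glue_base_le hu h₁ hT hKk hσ,
    fun σ hσ l => hit_glue_le hu h₁ hT hK0 hKk hσ l, ?_⟩
  · dsimp only
    split_ifs
    exacts [le_rfl, hit_nonneg (hK0 _ _) _ _]
  have hcell : ∀ i c, mg x ν₁ i ≠ 0 → mg x ν₂ c ≠ 0 →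
      ∑ ρ, condLaw x u ν₁ i ρ * ∑ l ∈ F.erase i,
        (lam l + T i l + if c = l then 0 else hit (K i c) ρ ((u i)⁻¹ l)) ^ 2 ≤
      2 * (N + 1) ^ 2 * (ent (condLaw x u ν₁ i) m' + ent (condLaw x u ν₂ c) m') +
        ((N + 1) * ∑ l ∈ F.erase i, (lam l + T i l) ^ 2 -
          if c ∈ F ∧ c ≠ i then N * lam c ^ 2 else 0) := by
    intro i c hi hc
    have hb := (hK i c hi hc).2
    have hp := condLaw_pr hu h₁ hi
    have e1 : ∀ ρ, ∑ l ∈ (F.erase i).erase c,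
        (lam l + T i l + if c = l then 0 else hit (K i c) ρ ((u i)⁻¹ l)) ^ 2 =
        ∑ l ∈ (F.erase i).erase c, (lam l + T i l + hit (K i c) ρ ((u i)⁻¹ l)) ^ 2 := fun ρ =>
      Finset.sum_congr rfl fun l hl => by rw [if_neg (Finset.ne_of_mem_erase hl).symm]
    by_cases hcF : c ∈ F.erase i
    · have hcF' : c ∈ F ∧ c ≠ i := (Finset.mem_erase.1 hcF).symm
      rw [if_pos hcF', ← Finset.add_sum_erase _ (fun l => (lam l + T i l) ^ 2) hcF]
      have e2 : ∀ ρ, ∑ l ∈ F.erase i,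
          (lam l + T i l + if c = l then 0 else hit (K i c) ρ ((u i)⁻¹ l)) ^ 2 =
          (lam c + T i c) ^ 2 +
          ∑ l ∈ (F.erase i).erase c, (lam l + T i l + hit (K i c) ρ ((u i)⁻¹ l)) ^ 2 := by
        intro ρ
        rw [← Finset.add_sum_erase _ _ hcF, e1]
        simp
      simp only [e2, mul_add (condLaw x u ν₁ i _), Finset.sum_add_distrib]
      rw [← Finset.sum_mul, hp.sum_one, one_mul]
      have h3 : lam c ^ 2 ≤ (lam c + T i c) ^ 2 :=
        pow_le_pow_left₀ (hlam c) (by linarith [hT.nonneg i c]) 2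
      have h4 := mul_le_mul_of_nonneg_left h3 hN
      linarith
    · have hcF' : ¬ (c ∈ F ∧ c ≠ i) := fun h0 => hcF (Finset.mem_erase.2 h0.symm)
      rw [if_neg hcF', sub_zero]
      rw [Finset.erase_eq_of_notMem hcF] at hb e1
      simp only [e1]
      exact hb
  rw [sum_mul_split hu h₁, h.ent_eq h₁ ha₁, h.ent_eq h₂ ha₂]
  have hrow : ∀ i, mg x ν₁ i * ∑ ρ, condLaw x u ν₁ i ρ * ∑ c, T ((u i * ρ) x) c *
      ∑ l ∈ F.erase ((u i * ρ) x), (lam l + T ((u i * ρ) x) l + if c = l then 0 else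
        hit (K ((u i * ρ) x) c) ((u ((u i * ρ) x))⁻¹ * (u i * ρ)) ((u ((u i * ρ) x))⁻¹ l)) ^ 2 ≤
      mg x ν₁ i * ∑ c, T i c * (2 * (N + 1) ^ 2 * (ent (condLaw x u ν₁ i) m' +
        ent (condLaw x u ν₂ c) m') + ((N + 1) * ∑ l ∈ F.erase i, (lam l + T i l) ^ 2 -
          if c ∈ F ∧ c ≠ i then N * lam c ^ 2 else 0)) := by
    intro i
    by_cases hi : mg x ν₁ i = 0
    · rw [hi, zero_mul, zero_mul]
    refine mul_le_mul_of_nonneg_left ?_ ((mg_pr h₁).nonneg i)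
    have e1 : ∀ ρ, condLaw x u ν₁ i ρ * ∑ c, T ((u i * ρ) x) c *
        ∑ l ∈ F.erase ((u i * ρ) x), (lam l + T ((u i * ρ) x) l + if c = l then 0 else
        hit (K ((u i * ρ) x) c) ((u ((u i * ρ) x))⁻¹ * (u i * ρ)) ((u ((u i * ρ) x))⁻¹ l)) ^ 2 =
        ∑ c, T i c * (condLaw x u ν₁ i ρ * ∑ l ∈ F.erase i, (lam l + T i l +
          if c = l then 0 else hit (K i c) ρ ((u i)⁻¹ l)) ^ 2) := by
      intro ρ
      by_cases hρ : ρ x = x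
      · rw [Equiv.Perm.mul_apply, hρ, hu, inv_mul_cancel_left, Finset.mul_sum]
        exact Finset.sum_congr rfl fun c _ => by ring
      · rw [condLaw_base_ne hρ]; simp
    rw [Finset.sum_congr rfl fun ρ _ => e1 ρ, Finset.sum_comm]
    refine Finset.sum_le_sum fun c _ => ?_
    rw [← Finset.mul_sum]
    by_cases hTc : T i c = 0
    · rw [hTc, zero_mul, zero_mul]
    exact mul_le_mul_of_nonneg_left (hcell i c hi (hT.mg_right_ne_zero h₁ hi hTc)) (hT.nonneg i c)
  refine (Finset.sum_le_sum fun i _ => hrow i).trans ?_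
  have hw := hT.sum_weights_le hN (mg_pr h₁) F lam
  have e7 : ∑ i, mg x ν₁ i * ∑ c, T i c * (2 * (N + 1) ^ 2 * (ent (condLaw x u ν₁ i) m' +
        ent (condLaw x u ν₂ c) m') + ((N + 1) * ∑ l ∈ F.erase i, (lam l + T i l) ^ 2 -
          if c ∈ F ∧ c ≠ i then N * lam c ^ 2 else 0)) =
      2 * (N + 1) ^ 2 * (∑ i, mg x ν₁ i * ent (condLaw x u ν₁ i) m' +
        ∑ c, mg x ν₂ c * ent (condLaw x u ν₂ c) m') +
      ∑ i, mg x ν₁ i * ∑ c, T i c * ((N + 1) * ∑ l ∈ F.erase i, (lam l + T i l) ^ 2 -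
          if c ∈ F ∧ c ≠ i then N * lam c ^ 2 else 0) := by
    have e8 : ∑ c, mg x ν₂ c * ent (condLaw x u ν₂ c) m' =
        ∑ i, mg x ν₁ i * ∑ c, T i c * ent (condLaw x u ν₂ c) m' := by
      simp only [← hT.marg, Finset.sum_mul, Finset.mul_sum]
      rw [Finset.sum_comm]
      exact Finset.sum_congr rfl fun i _ => Finset.sum_congr rfl fun c _ => by ring
    rw [e8, ← Finset.sum_add_distrib, Finset.mul_sum, ← Finset.sum_add_distrib]
    refine Finset.sum_congr rfl fun i _ => ?_
    have e9 : ent (condLaw x u ν₁ i) m' = ∑ c, T i c * ent (condLaw x u ν₁ i) m' := by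
      rw [← Finset.sum_mul, hT.row, one_mul]
    simp only [mul_add (T i _), Finset.sum_add_distrib]
    have e10 : ∑ c, T i c * (2 * (N + 1) ^ 2 * (ent (condLaw x u ν₁ i) m' +
        ent (condLaw x u ν₂ c) m')) = 2 * (N + 1) ^ 2 * (ent (condLaw x u ν₁ i) m' +
        ∑ c, T i c * ent (condLaw x u ν₂ c) m') := by
      conv_rhs => rw [e9, ← Finset.sum_add_distrib, Finset.mul_sum]
      exact Finset.sum_congr rfl fun c _ => by ring
    rw [e10]
    ring
  rw [e7]
  linarith

end StepBound

/-! ### Averaging the one-step kernels -/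

section Averaging

lemma sq_sum_weights_le {ι : Type*} (s : Finset ι) {w z : ι → ℝ} (hw : ∀ i ∈ s, 0 ≤ w i) :
    (∑ i ∈ s, w i * z i) ^ 2 ≤ (∑ i ∈ s, w i) * ∑ i ∈ s, w i * z i ^ 2 :=
  Finset.sum_sq_le_sum_mul_sum_of_sq_le_mul s hw (fun i hi => mul_nonneg (hw i hi) (sq_nonneg _))
    (fun i _ => le_of_eq (by ring))

lemma IsKernel.average {X ι : Type*} [Fintype X] {P Q : X → ℝ} {s : Finset ι} (hs : s.Nonempty)
    {p : ι → X → X → ℝ} (hp : ∀ i ∈ s, IsKernel P Q (p i)) :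
    IsKernel P Q (fun a b => (∑ i ∈ s, p i a b) / s.card) := by
  have hc : (s.card : ℝ) ≠ 0 := by simpa using hs.ne_empty
  refine ⟨fun a b => div_nonneg (Finset.sum_nonneg fun i hi => (hp i hi).nonneg a b)
    (Nat.cast_nonneg _), fun a ha => ?_, fun b => ?_⟩
  · rw [← Finset.sum_div, Finset.sum_comm, Finset.sum_congr rfl fun i hi => (hp i hi).row a ha]
    simp [hc]
  · simp only [← mul_div_assoc, Finset.mul_sum]
    rw [← Finset.sum_div, Finset.sum_comm, Finset.sum_congr rfl fun i hi => (hp i hi).marg b]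
    simp [hc]

variable {V : Type*} [Fintype V] [DecidableEq V] {N : ℝ} {A : Finset V} {x : V} {q : V → ℝ}
  {m m' : Equiv.Perm V → ℝ} {ν₁ ν₂ : Equiv.Perm V → ℝ} {T : V → V → ℝ}

lemma hit_average {ι : Type*} (s : Finset ι) (p : ι → Equiv.Perm V → Equiv.Perm V → ℝ)
    (σ : Equiv.Perm V) (l : V) :
    hit (fun a b => (∑ i ∈ s, p i a b) / s.card) σ l = (∑ i ∈ s, hit (p i) σ l) / s.card := by
  unfold hit
  rw [Finset.sum_comm, Finset.sum_div]
  refine Finset.sum_congr rfl fun τ _ => ?_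
  rw [div_mul_eq_mul_div, Finset.sum_mul]

/-- Bound on the proportion of base elements moving a label. -/
def spreadRate (N : ℝ) (A : Finset V) (x l : V) : ℝ :=
  if l = x then 1 else (N - 2) / (A.card - 2)

lemma exists_average_step (hN : 2 ≤ N) (hA : N * (N + 1) < A.card) {W : Finset (Equiv.Perm V)}
    (hW : W.Nonempty) {u : Equiv.Perm V → V → Equiv.Perm V}
    (h : ∀ g ∈ W, Split A m x q m' (u g))
    (hspread : ∀ i ∈ A, ∀ l ∈ A, l ≠ x → l ≠ i →
      (∑ g ∈ W, if u g i l = l then (0 : ℝ) else 1) * (A.card - 2) ≤ (N / 2 - 1) * W.card)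
    (IH : TransportBound N (A.erase x) m')
    (h₁ : IsPr ν₁) (h₂ : IsPr ν₂) (ha₁ : ∀ X, m X = 0 → ν₁ X = 0) (ha₂ : ∀ X, m X = 0 → ν₂ X = 0)
    (hor : ν₁ = m ∨ ν₂ = m) {F : Finset V} (hF : F ⊆ A) {lam : V → ℝ} (hlam : ∀ l, 0 ≤ lam l)
    (hT : IsTV (mg x ν₁) (mg x ν₂) T) :
    ∃ (p : Equiv.Perm V → Equiv.Perm V → ℝ) (Z : Equiv.Perm V → V → ℝ),
      IsKernel ν₁ ν₂ p ∧ (∀ σ l, 0 ≤ Z σ l) ∧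
      (∀ σ, ν₁ σ ≠ 0 → hit p σ (σ x) ≤ 1 - T (σ x) (σ x)) ∧
      (∀ σ, ν₁ σ ≠ 0 → ∀ l ∈ A, l ≠ σ x →
        hit p σ l ≤ Z σ l + spreadRate N A x l * (1 - T (σ x) (σ x))) ∧
      ∑ σ, ν₁ σ * ∑ l ∈ F.erase (σ x), (lam l + Z σ l) ^ 2 ≤
        2 * (N + 1) ^ 2 * (ent ν₁ m + ent ν₂ m - ent (mg x ν₁) q - ent (mg x ν₂) q) +
        ((N + 1) * ∑ l ∈ F, lam l ^ 2 + stepResidual N (mg x ν₁) (mg x ν₂) T F lam) := by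
  have hc : (0 : ℝ) < W.card := by exact_mod_cast hW.card_pos
  have hA2 : (0 : ℝ) < A.card - 2 := by nlinarith
  have hstep : ∀ g, ∃ (p : Equiv.Perm V → Equiv.Perm V → ℝ) (Y : Equiv.Perm V → V → V → ℝ),
      g ∈ W → IsKernel ν₁ ν₂ p ∧ (∀ σ c l, 0 ≤ Y σ c l) ∧
      (∀ σ, ν₁ σ ≠ 0 → hit p σ (σ x) ≤ 1 - T (σ x) (σ x)) ∧
      (∀ σ, ν₁ σ ≠ 0 → ∀ l, hit p σ l ≤ T (σ x) l + ∑ c, T (σ x) c * (Y σ c l +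
        if c = l then 0 else if u g c ((u g (σ x))⁻¹ l) = l then 0 else 1)) ∧
      ∑ σ, ν₁ σ * ∑ c, T (σ x) c * ∑ l ∈ F.erase (σ x), (lam l + T (σ x) l + Y σ c l) ^ 2 ≤
        2 * (N + 1) ^ 2 * (ent ν₁ m + ent ν₂ m - ent (mg x ν₁) q - ent (mg x ν₂) q) +
        ((N + 1) * ∑ l ∈ F, lam l ^ 2 + stepResidual N (mg x ν₁) (mg x ν₂) T F lam) := by
    intro g
    by_cases hg : g ∈ W
    · obtain ⟨p, Y, hpY⟩ := (h g hg).exists_step (by linarith) IH h₁ h₂ ha₁ ha₂ hor hF hlam hT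
      exact ⟨p, Y, fun _ => hpY⟩
    · exact ⟨fun _ _ => 0, fun _ _ _ => 0, fun h0 => absurd h0 hg⟩
  choose p Y hpY using hstep
  set R := 2 * (N + 1) ^ 2 * (ent ν₁ m + ent ν₂ m - ent (mg x ν₁) q - ent (mg x ν₂) q) +
        ((N + 1) * ∑ l ∈ F, lam l ^ 2 + stepResidual N (mg x ν₁) (mg x ν₂) T F lam) with hR
  set Z : Equiv.Perm V → V → ℝ := fun σ l =>
    (∑ g ∈ W, ∑ c, T (σ x) c * (T (σ x) l + Y g σ c l)) / W.card with hZ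
  refine ⟨fun a b => (∑ g ∈ W, p g a b) / W.card, Z,
    IsKernel.average hW fun g hg => (hpY g hg).1, fun σ l => ?_, fun σ hσ => ?_,
    fun σ hσ l hlA hl => ?_, ?_⟩
  · exact div_nonneg (Finset.sum_nonneg fun g hg => Finset.sum_nonneg fun c _ =>
      mul_nonneg (hT.nonneg _ _) (add_nonneg (hT.nonneg _ _) ((hpY g hg).2.1 σ c l))) hc.le
  · rw [hit_average, div_le_iff₀ hc, mul_comm, ← nsmul_eq_mul, ← Finset.sum_const]
    exact Finset.sum_le_sum fun g hg => (hpY g hg).2.2.1 σ hσ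
  · set i := σ x with hi
    have hmi := mg_ne_zero (x := x) h₁ hσ
    rw [← hi] at hmi
    obtain ⟨g₀, hg₀⟩ := hW
    have hiA : i ∈ A := by
      by_contra h0
      exact hmi ((h g₀ hg₀).mg_ac ha₁ i ((h g₀ hg₀).q_off i h0))
    have hcA : ∀ c, T i c ≠ 0 → c ∈ A := by
      intro c hTc
      by_contra h0
      exact hT.mg_right_ne_zero h₁ hmi hTc ((h g₀ hg₀).mg_ac ha₂ c ((h g₀ hg₀).q_off c h0))
    have hrate : ∀ c, T i c ≠ 0 → c ≠ i →
        ∑ g ∈ W, (if c = l then (0 : ℝ) else if u g c ((u g i)⁻¹ l) = l then 0 else 1) ≤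
          spreadRate N A x l * W.card := by
      intro c hTc hci
      unfold spreadRate
      split_ifs with hcl hlx hlx
      · simp
      · simp only [Finset.sum_const_zero]
        exact mul_nonneg (div_nonneg (by linarith) hA2.le) hc.le
      · rw [mul_comm, ← nsmul_eq_mul, ← Finset.sum_const]
        exact Finset.sum_le_sum fun g _ => by split_ifs <;> norm_num
      · have e1 := hspread i hiA l hlA hlx hl
        have e2 := hspread c (hcA c hTc) l hlA hlx (Ne.symm hcl)
        have e3 : ∑ g ∈ W, (if u g c ((u g i)⁻¹ l) = l then (0 : ℝ) else 1) ≤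
            ∑ g ∈ W, (if u g i l = l then (0 : ℝ) else 1) +
            ∑ g ∈ W, (if u g c l = l then (0 : ℝ) else 1) := by
          rw [← Finset.sum_add_distrib]
          refine Finset.sum_le_sum fun g _ => ?_
          by_cases h3 : u g i l = l
          · rw [show (u g i)⁻¹ l = l by rw [Equiv.Perm.inv_eq_iff_eq, h3]]
            simp [h3]
          · rw [if_neg h3]; split_ifs <;> norm_num
        rw [div_mul_eq_mul_div, le_div_iff₀ hA2]
        have e4 := mul_le_mul_of_nonneg_right e3 hA2.le
        linarith
    have hzero : ∀ g, (if i = l then (0 : ℝ) else if u g i ((u g i)⁻¹ l) = l then 0 else 1) = 0 := by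
      intro g; simp
    rw [hit_average, div_le_iff₀ hc, add_mul]
    simp only [hZ]
    rw [div_mul_cancel₀ _ hc.ne']
    calc ∑ g ∈ W, hit (p g) σ l
        ≤ ∑ g ∈ W, (∑ c, T i c * (T i l + Y g σ c l) + ∑ c, T i c *
            (if c = l then 0 else if u g c ((u g i)⁻¹ l) = l then 0 else 1)) := by
          refine Finset.sum_le_sum fun g hg => ((hpY g hg).2.2.2.1 σ hσ l).trans (le_of_eq ?_)
          simp only [mul_add, Finset.sum_add_distrib, ← Finset.sum_mul, hT.row]
          rw [one_mul, add_assoc]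
      _ = ∑ g ∈ W, ∑ c, T i c * (T i l + Y g σ c l) + ∑ c, T i c *
            ∑ g ∈ W, (if c = l then 0 else if u g c ((u g i)⁻¹ l) = l then 0 else 1) := by
          rw [Finset.sum_add_distrib, Finset.sum_comm (s := W) (f := fun g c => T i c *
            (if c = l then 0 else if u g c ((u g i)⁻¹ l) = l then 0 else 1))]
          simp only [Finset.mul_sum]
      _ ≤ _ := by
          refine add_le_add_right ?_ _
          rw [← hT.off_row, ← Finset.add_sum_erase Finset.univ _ (Finset.mem_univ i)]
          simp only [hzero, Finset.sum_const_zero, mul_zero, zero_add]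
          rw [mul_right_comm, Finset.mul_sum]
          refine Finset.sum_le_sum fun c hci => ?_
          by_cases hTc : T i c = 0
          · rw [hTc]; simp
          rw [mul_comm (T i c)]
          exact mul_le_mul_of_nonneg_right (hrate c hTc (Finset.ne_of_mem_erase hci)) (hT.nonneg _ _)
  · have hj : ∀ σ l, (lam l + Z σ l) ^ 2 ≤
        (∑ g ∈ W, ∑ c, T (σ x) c * (lam l + T (σ x) l + Y g σ c l) ^ 2) / W.card := by
      intro σ l
      have e1 : lam l + Z σ l =
          (∑ g ∈ W, ∑ c, T (σ x) c * (lam l + T (σ x) l + Y g σ c l)) / W.card := by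
        have : ∑ g ∈ W, ∑ c, T (σ x) c * (lam l + T (σ x) l + Y g σ c l) = W.card * lam l +
            ∑ g ∈ W, ∑ c, T (σ x) c * (T (σ x) l + Y g σ c l) := by
          rw [← nsmul_eq_mul, ← Finset.sum_const, ← Finset.sum_add_distrib]
          refine Finset.sum_congr rfl fun g _ => ?_
          simp only [add_assoc, mul_add (T _ _) (lam l), Finset.sum_add_distrib, ← Finset.sum_mul,
            hT.row, one_mul]
        rw [this]; simp only [hZ]; field_simp
      rw [e1, div_pow, div_le_div_iff₀ (by positivity) hc]
      have e2 := sq_sum_le_card_mul_sum_sq (s := W)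
        (f := fun g => ∑ c, T (σ x) c * (lam l + T (σ x) l + Y g σ c l))
      have e3 : ∑ g ∈ W, (∑ c, T (σ x) c * (lam l + T (σ x) l + Y g σ c l)) ^ 2 ≤
          ∑ g ∈ W, ∑ c, T (σ x) c * (lam l + T (σ x) l + Y g σ c l) ^ 2 := by
        refine Finset.sum_le_sum fun g _ => ?_
        have := sq_sum_weights_le Finset.univ (w := fun c => T (σ x) c)
          (z := fun c => lam l + T (σ x) l + Y g σ c l) (fun c _ => hT.nonneg _ c)
        rwa [hT.row, one_mul] at this
      calc _ ≤ W.card * (∑ g ∈ W, ∑ c, T (σ x) c * (lam l + T (σ x) l + Y g σ c l) ^ 2) * W.card :=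
            mul_le_mul_of_nonneg_right (e2.trans (mul_le_mul_of_nonneg_left e3 hc.le)) hc.le
        _ = _ := by ring
    calc ∑ σ, ν₁ σ * ∑ l ∈ F.erase (σ x), (lam l + Z σ l) ^ 2
        ≤ ∑ σ, ν₁ σ * ∑ l ∈ F.erase (σ x),
          (∑ g ∈ W, ∑ c, T (σ x) c * (lam l + T (σ x) l + Y g σ c l) ^ 2) / W.card :=
          Finset.sum_le_sum fun σ _ => mul_le_mul_of_nonneg_left
            (Finset.sum_le_sum fun l _ => hj σ l) (h₁.nonneg σ)
      _ = (∑ g ∈ W, ∑ σ, ν₁ σ * ∑ c, T (σ x) c *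
            ∑ l ∈ F.erase (σ x), (lam l + T (σ x) l + Y g σ c l) ^ 2) / W.card := by
          rw [Finset.sum_comm, Finset.sum_div]
          refine Finset.sum_congr rfl fun σ _ => ?_
          rw [← Finset.sum_div, ← mul_div_assoc, Finset.sum_comm, ← Finset.mul_sum]
          congr 2
          refine Finset.sum_congr rfl fun g _ => ?_
          rw [Finset.sum_comm]
          exact Finset.sum_congr rfl fun c _ => by rw [Finset.mul_sum]
      _ ≤ (∑ g ∈ W, R) / W.card :=
          div_le_div_of_nonneg_right (Finset.sum_le_sum fun g hg => (hpY g hg).2.2.2.2) hc.le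
      _ = R := by rw [Finset.sum_const, nsmul_eq_mul]; field_simp

end Averaging

/-! ### Averaging over the split point -/

section LevelStep

variable {V : Type*} [Fintype V] [DecidableEq V] {N : ℝ} {A : Finset V}

lemma IsTV.stepResidual_le (hN : 1 ≤ N) {P Q : V → ℝ} {T : V → V → ℝ} (hT : IsTV P Q T)
    (hP : IsPr P) (hQ : IsPr Q) (F : Finset V) (lam : V → ℝ) :
    ∑ i, P i * (N * (if i ∈ F then lam i else 0) ^ 2 +
        2 * (if i ∈ F then lam i else 0) * (1 - T i i) + (N ^ 2 + N - 1) * (1 - T i i) ^ 2) +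
      stepResidual N P Q T F lam ≤
      (N + 1) ^ 2 * (∑ i, P i * (1 - T i i) ^ 2 + ∑ c, max (Q c - P c) 0 ^ 2 / Q c) := by
  unfold stepResidual
  rw [← Finset.sum_add_distrib, ← Finset.sum_add_distrib, Finset.mul_sum]
  refine Finset.sum_le_sum fun i _ => ?_
  generalize (if i ∈ F then lam i else 0) = θ
  have hd := hT.diag i
  have hPi := hP.nonneg i
  have hQi := hQ.nonneg i
  set ε := 1 - T i i with hε
  rcases le_or_gt (Q i) (P i) with h | h
  · rw [max_eq_right (by linarith : Q i - P i ≤ 0)]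
    have : 0 ≤ P i * (θ - ε) ^ 2 := by positivity
    simp only [ne_eq, OfNat.ofNat_ne_zero, not_false_eq_true, zero_pow, zero_div]
    nlinarith
  · rw [max_eq_right (by linarith : P i - Q i ≤ 0)] at hd
    rw [max_eq_left (by linarith : 0 ≤ Q i - P i)]
    have hQ0 : 0 < Q i := by linarith
    set a := Q i - P i with ha
    have h1 : P i * ε ^ 2 = 0 := by rw [sq, ← mul_assoc, hd, zero_mul]
    have h2 : 2 * (N + 1) * θ * a ≤ θ ^ 2 * Q i + (N + 1) ^ 2 * (a ^ 2 / Q i) := by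
      have h3 : θ ^ 2 * Q i + (N + 1) ^ 2 * (a ^ 2 / Q i) - 2 * (N + 1) * θ * a =
          (θ * Q i - (N + 1) * a) ^ 2 / Q i := by field_simp; ring
      have : 0 ≤ (θ * Q i - (N + 1) * a) ^ 2 / Q i := by positivity
      linarith
    have h4 : 0 ≤ (N - 1) * (θ ^ 2 * a) :=
      mul_nonneg (by linarith) (mul_nonneg (sq_nonneg _) (by linarith))
    have h5 : θ ^ 2 * Q i = θ ^ 2 * a + P i * θ ^ 2 := by rw [ha]; ring
    have e : P i * (N * θ ^ 2 + 2 * θ * ε + (N ^ 2 + N - 1) * ε ^ 2) =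
      N * (P i * θ ^ 2) + 2 * θ * (P i * ε) + (N ^ 2 + N - 1) * (P i * ε ^ 2) := by ring
    rw [e, hd, h1]
    linarith

omit [Fintype V] in
lemma sum_erase_rate_le (hN : 2 ≤ N) (hA : N * (N + 1) < A.card) {a b : V}
    (hb : b ∈ A) :
    ∑ y ∈ A.erase b, (if y = a then (1 : ℝ) else (N - 2) / (A.card - 2)) ≤ N - 1 := by
  have hA2 : (0 : ℝ) < A.card - 2 := by nlinarith
  set r := (N - 2) / ((A.card : ℝ) - 2) with hr
  have hr1 : r ≤ 1 := by rw [hr, div_le_one hA2]; nlinarith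
  have hr2 : ((A.card : ℝ) - 2) * r = N - 2 := by rw [hr]; field_simp
  have e : ∀ y ∈ A.erase b, (if y = a then (1 : ℝ) else r) = r + if y = a then 1 - r else 0 := by
    intro y _; split_ifs <;> ring
  rw [Finset.sum_congr rfl e, Finset.sum_add_distrib, Finset.sum_const, Finset.card_erase_of_mem hb,
    Finset.sum_ite_eq', nsmul_eq_mul, Nat.cast_sub (Finset.card_pos.2 ⟨b, hb⟩)]
  split_ifs <;> push_cast <;> linarith

omit [Fintype V] in
lemma sum_sq_levelWeights_le (hN : 2 ≤ N) (hA : N * (N + 1) < A.card) {σ : Equiv.Perm V}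
    (hσ : ∀ x, σ x ∈ A ↔ x ∈ A) {F : Finset V} (hF : F ⊆ A) {lam : V → ℝ} {e : V → ℝ} :
    ∑ l ∈ F, (lam l + (e (σ⁻¹ l) + ∑ x ∈ A.erase (σ⁻¹ l), spreadRate N A x l * e x)) ^ 2 ≤
      ∑ x ∈ A, (N * (if σ x ∈ F then lam (σ x) else 0) ^ 2 +
        2 * (if σ x ∈ F then lam (σ x) else 0) * e x + (N ^ 2 + N - 1) * e x ^ 2) := by
  have hA2 : (0 : ℝ) < A.card - 2 := by nlinarith
  have hβ : ∀ x l, 0 ≤ spreadRate N A x l := by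
    intro x l; unfold spreadRate; split_ifs
    exacts [zero_le_one, div_nonneg (by linarith) hA2.le]
  have hpt : ∀ l ∈ F, (lam l + (e (σ⁻¹ l) + ∑ x ∈ A.erase (σ⁻¹ l), spreadRate N A x l * e x)) ^ 2 ≤
      N * lam l ^ 2 + 2 * lam l * e (σ⁻¹ l) + N * e (σ⁻¹ l) ^ 2 +
        (1 + N) * ∑ x ∈ A.erase (σ⁻¹ l), spreadRate N A x l * e x ^ 2 := by
    intro l hl
    have hlA := hF hl
    have hx0 : σ⁻¹ l ∈ A := by rw [← hσ]; simpa using hlA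
    set e0 := e (σ⁻¹ l)
    have hB : ∑ x ∈ A.erase (σ⁻¹ l), spreadRate N A x l ≤ N - 1 := by
      refine le_trans (le_of_eq ?_) (sum_erase_rate_le hN hA (a := l) hx0)
      exact Finset.sum_congr rfl fun x _ => by unfold spreadRate; simp only [eq_comm]
    have hB0 : 0 ≤ ∑ x ∈ A.erase (σ⁻¹ l), spreadRate N A x l := Finset.sum_nonneg fun x _ => hβ x l
    have hS0 : 0 ≤ ∑ x ∈ A.erase (σ⁻¹ l), spreadRate N A x l * e x ^ 2 :=
      Finset.sum_nonneg fun x _ => mul_nonneg (hβ x l) (sq_nonneg _)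
    have hC := sq_sum_weights_le (A.erase (σ⁻¹ l)) (w := fun x => spreadRate N A x l) (z := e)
      (fun x _ => hβ x l)
    have hD : 2 * lam l * ∑ x ∈ A.erase (σ⁻¹ l), spreadRate N A x l * e x ≤
        lam l ^ 2 * ∑ x ∈ A.erase (σ⁻¹ l), spreadRate N A x l +
          ∑ x ∈ A.erase (σ⁻¹ l), spreadRate N A x l * e x ^ 2 := by
      rw [Finset.mul_sum, Finset.mul_sum, ← Finset.sum_add_distrib]
      refine Finset.sum_le_sum fun x _ => ?_
      have := mul_nonneg (hβ x l) (sq_nonneg (lam l - e x))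
      nlinarith
    generalize ∑ x ∈ A.erase (σ⁻¹ l), spreadRate N A x l * e x ^ 2 = S at *
    generalize ∑ x ∈ A.erase (σ⁻¹ l), spreadRate N A x l * e x = Y at *
    generalize ∑ x ∈ A.erase (σ⁻¹ l), spreadRate N A x l = B at *
    have h1 : 2 * e0 * Y ≤ B * e0 ^ 2 + S := by
      rcases hB0.eq_or_lt with h0 | h0
      · have : Y = 0 := by
          rw [← h0, zero_mul] at hC
          exact pow_eq_zero_iff (two_ne_zero) |>.1 (le_antisymm hC (sq_nonneg _))
        rw [this, ← h0]; linarith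
      · have h2 : Y ^ 2 / B ≤ S := by rw [div_le_iff₀ h0]; linarith
        have h3 : B * e0 ^ 2 + Y ^ 2 / B - 2 * e0 * Y = (B * e0 - Y) ^ 2 / B := by
          field_simp; ring
        have : 0 ≤ (B * e0 - Y) ^ 2 / B := by positivity
        linarith
    have h5 : B * S ≤ (N - 1) * S := mul_le_mul_of_nonneg_right hB hS0
    have h6 : B * e0 ^ 2 ≤ (N - 1) * e0 ^ 2 := mul_le_mul_of_nonneg_right hB (sq_nonneg _)
    have h7 : lam l ^ 2 * B ≤ lam l ^ 2 * (N - 1) := mul_le_mul_of_nonneg_left hB (sq_nonneg _)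
    nlinarith
  have hre : ∀ f : V → V → ℝ, ∑ l ∈ F, f l (σ⁻¹ l) = ∑ x ∈ A, if σ x ∈ F then f (σ x) x else 0 := by
    intro f
    rw [← Finset.sum_filter]
    refine Finset.sum_bij' (fun l _ => σ⁻¹ l) (fun x _ => σ x) ?_ ?_ ?_ ?_ ?_
    · intro l hl
      have : σ (σ⁻¹ l) = l := by simp
      rw [Finset.mem_filter, this, ← hσ, this]
      exact ⟨hF hl, hl⟩
    · intro x hx; exact (Finset.mem_filter.1 hx).2
    · intro l _; simp
    · intro x _; simp
    · intro l _; simp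
  refine (Finset.sum_le_sum hpt).trans ?_
  have hcol : ∑ l ∈ F, ∑ x ∈ A.erase (σ⁻¹ l), spreadRate N A x l * e x ^ 2 ≤
      (N - 1) * ∑ x ∈ A, e x ^ 2 := by
    calc ∑ l ∈ F, ∑ x ∈ A.erase (σ⁻¹ l), spreadRate N A x l * e x ^ 2
        ≤ ∑ l ∈ A, ∑ x ∈ A.erase (σ⁻¹ l), spreadRate N A x l * e x ^ 2 :=
          Finset.sum_le_sum_of_subset_of_nonneg hF fun l _ _ =>
            Finset.sum_nonneg fun x _ => mul_nonneg (hβ x l) (sq_nonneg _)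
      _ = ∑ x ∈ A, ∑ l ∈ A.erase (σ x), spreadRate N A x l * e x ^ 2 := by
          refine Finset.sum_comm' fun l x => ?_
          simp only [Finset.mem_erase, ne_eq]
          rw [Equiv.Perm.eq_inv_iff_eq, eq_comm]
          tauto
      _ ≤ ∑ x ∈ A, (N - 1) * e x ^ 2 := by
          refine Finset.sum_le_sum fun x hx => ?_
          rw [← Finset.sum_mul]
          exact mul_le_mul_of_nonneg_right (sum_erase_rate_le hN hA ((hσ x).2 hx)) (sq_nonneg _)
      _ = _ := by rw [Finset.mul_sum]
  have h1 : ∑ l ∈ F, (N * lam l ^ 2 + 2 * lam l * e (σ⁻¹ l) + N * e (σ⁻¹ l) ^ 2) ≤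
      ∑ x ∈ A, (N * (if σ x ∈ F then lam (σ x) else 0) ^ 2 +
        2 * (if σ x ∈ F then lam (σ x) else 0) * e x + N * e x ^ 2) := by
    rw [hre fun l x => N * lam l ^ 2 + 2 * lam l * e x + N * e x ^ 2]
    refine Finset.sum_le_sum fun x _ => ?_
    split_ifs
    · exact le_rfl
    · have : 0 ≤ N * e x ^ 2 := mul_nonneg (by linarith) (sq_nonneg _)
      linarith
  rw [Finset.sum_add_distrib, ← Finset.mul_sum]
  have h2 := mul_le_mul_of_nonneg_left hcol (show 0 ≤ 1 + N by linarith)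
  refine (add_le_add h1 h2).trans (le_of_eq ?_)
  rw [← mul_assoc, Finset.mul_sum, ← Finset.sum_add_distrib]
  exact Finset.sum_congr rfl fun x _ => by ring

lemma Split.fixesOff {m m' : Equiv.Perm V → ℝ} {x : V} {q : V → ℝ} {u : V → Equiv.Perm V}
    (h : Split A m x q m' u) {X : Equiv.Perm V} (hX : m X ≠ 0) : FixesOff A X := by
  rw [h.eq] at hX
  have hi : X x ∈ A := by
    by_contra h0; exact left_ne_zero_of_mul hX (h.q_off _ h0)
  intro v hv
  have h1 := h.m'_off _ (right_ne_zero_of_mul hX) v fun h0 => hv (Finset.mem_of_mem_erase h0)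
  rw [Equiv.Perm.mul_apply, Equiv.Perm.inv_eq_iff_eq, h.u_off _ hi v hv] at h1
  exact h1

omit [Fintype V] in
lemma FixesOff.mem_iff {σ : Equiv.Perm V} (h : FixesOff A σ) (x : V) : σ x ∈ A ↔ x ∈ A := by
  constructor
  · intro h1
    by_contra h2
    rw [h x h2] at h1
    exact h2 h1
  · intro h1
    by_contra h2
    exact h2 (by rwa [σ.injective (h _ h2)])

lemma transportBound_of_split (hN : 2 ≤ N) (hA : N * (N + 1) < A.card) {m : Equiv.Perm V → ℝ}
    {q : V → V → ℝ} {m' : V → Equiv.Perm V → ℝ} {W : V → Finset (Equiv.Perm V)}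
    {u : V → Equiv.Perm V → V → Equiv.Perm V} (hW : ∀ x ∈ A, (W x).Nonempty)
    (h : ∀ x ∈ A, ∀ g ∈ W x, Split A m x (q x) (m' x) (u x g))
    (hspread : ∀ x ∈ A, ∀ i ∈ A, ∀ l ∈ A, l ≠ x → l ≠ i →
      (∑ g ∈ W x, if u x g i l = l then (0 : ℝ) else 1) * (A.card - 2) ≤ (N / 2 - 1) * (W x).card)
    (IH : ∀ x ∈ A, TransportBound N (A.erase x) (m' x)) : TransportBound N A m := by
  intro ν₁ ν₂ h₁ h₂ ha₁ ha₂ hor F hF lam hlam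
  have hc : (0 : ℝ) < A.card := by nlinarith
  have hAne : A.Nonempty := by
    rw [← Finset.card_pos]; exact_mod_cast hc
  choose T hT using fun x => exists_isTV (mg_pr (x := x) h₁) (mg_pr (x := x) h₂)
  have hstep : ∀ x, ∃ (p : Equiv.Perm V → Equiv.Perm V → ℝ) (Z : Equiv.Perm V → V → ℝ), x ∈ A →
      IsKernel ν₁ ν₂ p ∧ (∀ σ l, 0 ≤ Z σ l) ∧
      (∀ σ, ν₁ σ ≠ 0 → hit p σ (σ x) ≤ 1 - T x (σ x) (σ x)) ∧
      (∀ σ, ν₁ σ ≠ 0 → ∀ l ∈ A, l ≠ σ x →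
        hit p σ l ≤ Z σ l + spreadRate N A x l * (1 - T x (σ x) (σ x))) ∧
      ∑ σ, ν₁ σ * ∑ l ∈ F.erase (σ x), (lam l + Z σ l) ^ 2 ≤
        2 * (N + 1) ^ 2 * (ent ν₁ m + ent ν₂ m - ent (mg x ν₁) (q x) - ent (mg x ν₂) (q x)) +
        ((N + 1) * ∑ l ∈ F, lam l ^ 2 +
          stepResidual N (mg x ν₁) (mg x ν₂) (T x) F lam) := by
    intro x
    by_cases hx : x ∈ A
    · obtain ⟨p, Z, hpZ⟩ := exists_average_step hN hA (hW x hx) (h x hx) (hspread x hx) (IH x hx)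
        h₁ h₂ ha₁ ha₂ hor hF hlam (hT x)
      exact ⟨p, Z, fun _ => hpZ⟩
    · exact ⟨fun _ _ => 0, fun _ _ => 0, fun h0 => absurd h0 hx⟩
  choose p Z hpZ using hstep
  refine ⟨fun a b => (∑ x ∈ A, p x a b) / A.card, IsKernel.average hAne fun x hx => (hpZ x hx).1, ?_⟩
  set P : Equiv.Perm V → Equiv.Perm V → ℝ := fun a b => (∑ x ∈ A, p x a b) / A.card with hP
  have hPn : ∀ σ τ, 0 ≤ P σ τ := (IsKernel.average hAne fun x hx => (hpZ x hx).1).nonneg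
  set ε : V → V → ℝ := fun x i => 1 - T x i i with hε
  set H : V → V → ℝ := fun x i => N * (if i ∈ F then lam i else 0) ^ 2 +
        2 * (if i ∈ F then lam i else 0) * ε x i + (N ^ 2 + N - 1) * ε x i ^ 2 with hH
  have key : ∀ σ, ν₁ σ ≠ 0 → A.card * ∑ l ∈ F, (lam l + hit P σ l) ^ 2 ≤
      ∑ x ∈ A, H x (σ x) + ∑ x ∈ A, ∑ l ∈ F.erase (σ x), (lam l + Z x σ l) ^ 2 := by
    intro σ hσ
    have hfix : FixesOff A σ := by
      obtain ⟨x, hx⟩ := hAne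
      obtain ⟨g, hg⟩ := hW x hx
      exact (h x hx g hg).fixesOff fun h0 => hσ (ha₁ σ h0)
    have hmem := hfix.mem_iff
    set Y : V → ℝ := fun l => ε (σ⁻¹ l) (σ (σ⁻¹ l)) +
      ∑ x ∈ A.erase (σ⁻¹ l), spreadRate N A x l * ε x (σ x) with hY
    have hpt : ∀ l ∈ F, A.card * (lam l + hit P σ l) ^ 2 ≤
        (lam l + Y l) ^ 2 + ∑ x ∈ A.erase (σ⁻¹ l), (lam l + Z x σ l) ^ 2 := by
      intro l hl
      have hlA := hF hl
      have hinv : σ (σ⁻¹ l) = l := by simp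
      have hx0 : σ⁻¹ l ∈ A := by rw [← hmem, hinv]; exact hlA
      set f : V → ℝ := fun x => if x = σ⁻¹ l then lam l + Y l else lam l + Z x σ l with hf
      have e1 : A.card * (lam l + hit P σ l) ≤ ∑ x ∈ A, f x := by
        rw [hP, hit_average, mul_add, mul_div_cancel₀ _ hc.ne', ← nsmul_eq_mul, ← Finset.sum_const,
          ← Finset.sum_add_distrib, ← Finset.add_sum_erase A _ hx0, ← Finset.add_sum_erase A f hx0]
        have e2 : ∑ x ∈ A.erase (σ⁻¹ l), f x = ∑ x ∈ A.erase (σ⁻¹ l), (lam l + Z x σ l) :=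
          Finset.sum_congr rfl fun x hx => by simp only [hf, if_neg (Finset.ne_of_mem_erase hx)]
        have e3 : f (σ⁻¹ l) = lam l + Y l := by simp [hf]
        rw [e2, e3]
        have e4 := (hpZ _ hx0).2.2.1 σ hσ
        rw [hinv] at e4
        have e5 : ∑ x ∈ A.erase (σ⁻¹ l), (lam l + hit (p x) σ l) ≤
            ∑ x ∈ A.erase (σ⁻¹ l), (lam l + Z x σ l) +
              ∑ x ∈ A.erase (σ⁻¹ l), spreadRate N A x l * ε x (σ x) := by
          rw [← Finset.sum_add_distrib]
          refine Finset.sum_le_sum fun x hx => ?_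
          have := (hpZ x (Finset.mem_of_mem_erase hx)).2.2.2.1 σ hσ l hlA (fun h0 =>
            Finset.ne_of_mem_erase hx (by rw [h0]; simp))
          simp only [hε]; linarith
        simp only [hY, hinv]
        simp only [hε] at e5 ⊢
        linarith
      have e6 : 0 ≤ A.card * (lam l + hit P σ l) :=
        mul_nonneg hc.le (add_nonneg (hlam l) (hit_nonneg hPn σ l))
      have e7 : (A.card * (lam l + hit P σ l)) ^ 2 ≤ A.card * ∑ x ∈ A, f x ^ 2 :=
        (pow_le_pow_left₀ e6 e1 2).trans sq_sum_le_card_mul_sum_sq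
      have e8 : ∑ x ∈ A, f x ^ 2 = (lam l + Y l) ^ 2 +
          ∑ x ∈ A.erase (σ⁻¹ l), (lam l + Z x σ l) ^ 2 := by
        rw [← Finset.add_sum_erase A _ hx0]
        congr 1
        · simp [hf]
        · exact Finset.sum_congr rfl fun x hx => by simp only [hf, if_neg (Finset.ne_of_mem_erase hx)]
      rw [← e8]
      rw [mul_pow, sq (A.card : ℝ), mul_assoc] at e7
      exact le_of_mul_le_mul_left e7 hc
    rw [Finset.mul_sum]
    refine (Finset.sum_le_sum hpt).trans ?_
    rw [Finset.sum_add_distrib]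
    refine add_le_add ?_ (le_of_eq ?_)
    · exact sum_sq_levelWeights_le hN hA hmem hF (lam := lam) (e := fun x => ε x (σ x))
    · refine Finset.sum_comm' fun l x => ?_
      simp only [Finset.mem_erase, ne_eq]
      rw [Equiv.Perm.eq_inv_iff_eq, eq_comm]
      tauto
  have hx : ∀ x ∈ A, ∑ i, mg x ν₁ i * H x i + stepResidual N (mg x ν₁) (mg x ν₂) (T x) F lam ≤
      2 * (N + 1) ^ 2 * (ent (mg x ν₁) (q x) + ent (mg x ν₂) (q x)) := by
    intro x hx
    obtain ⟨g, hg⟩ := hW x hx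
    have hs := h x hx g hg
    refine ((hT x).stepResidual_le (by linarith) (mg_pr h₁) (mg_pr h₂) F lam).trans ?_
    have hor' : mg x ν₁ = q x ∨ mg x ν₂ = q x :=
      hor.imp (fun h0 => by rw [h0]; exact funext hs.mg_eq)
        (fun h0 => by rw [h0]; exact funext hs.mg_eq)
    have := (hT x).cost_le (mg_pr h₁) (mg_pr h₂) (hs.mg_ac ha₁) (hs.mg_ac ha₂) hor'
    nlinarith [mul_le_mul_of_nonneg_left this (sq_nonneg (N + 1))]
  refine le_of_mul_le_mul_left ?_ hc
  calc (A.card : ℝ) * ∑ σ, ν₁ σ * ∑ l ∈ F, (lam l + hit P σ l) ^ 2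
      = ∑ σ, ν₁ σ * (A.card * ∑ l ∈ F, (lam l + hit P σ l) ^ 2) := by
        rw [Finset.mul_sum]; exact Finset.sum_congr rfl fun σ _ => by ring
    _ ≤ ∑ σ, ν₁ σ * (∑ x ∈ A, H x (σ x) +
          ∑ x ∈ A, ∑ l ∈ F.erase (σ x), (lam l + Z x σ l) ^ 2) := by
        refine Finset.sum_le_sum fun σ _ => ?_
        by_cases hσ : ν₁ σ = 0
        · simp [hσ]
        · exact mul_le_mul_of_nonneg_left (key σ hσ) (h₁.nonneg σ)
    _ = ∑ x ∈ A, (∑ i, mg x ν₁ i * H x i +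
          ∑ σ, ν₁ σ * ∑ l ∈ F.erase (σ x), (lam l + Z x σ l) ^ 2) := by
        simp only [← sum_mg_mul]
        rw [Finset.sum_add_distrib, Finset.sum_comm (s := A), Finset.sum_comm (s := A),
          ← Finset.sum_add_distrib]
        exact Finset.sum_congr rfl fun σ _ => by rw [← Finset.mul_sum, ← Finset.mul_sum, mul_add]
    _ ≤ ∑ x ∈ A, (2 * (N + 1) ^ 2 * (ent ν₁ m + ent ν₂ m) + (N + 1) * ∑ l ∈ F, lam l ^ 2) := by
        refine Finset.sum_le_sum fun x hxA => ?_
        have e1 := (hpZ x hxA).2.2.2.2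
        have e2 := hx x hxA
        linarith
    _ = _ := by rw [Finset.sum_const, nsmul_eq_mul]

/-- Measures admitting, down to a small set of points, splittings at every point whose translating
permutations can be averaged so as to move each label rarely. -/
inductive IsSpread (N : ℝ) : Finset V → (Equiv.Perm V → ℝ) → Prop
  | small {A : Finset V} {m : Equiv.Perm V → ℝ} (h : (A.card : ℝ) ≤ N * (N + 1)) : IsSpread N A m
  | step {A : Finset V} {m : Equiv.Perm V → ℝ} {q : V → V → ℝ} {m' : V → Equiv.Perm V → ℝ}
      {W : V → Finset (Equiv.Perm V)} {u : V → Equiv.Perm V → V → Equiv.Perm V}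
      (hA : N * (N + 1) < A.card) (hW : ∀ x ∈ A, (W x).Nonempty)
      (h : ∀ x ∈ A, ∀ g ∈ W x, Split A m x (q x) (m' x) (u x g))
      (hspread : ∀ x ∈ A, ∀ i ∈ A, ∀ l ∈ A, l ≠ x → l ≠ i →
        (∑ g ∈ W x, if u x g i l = l then (0 : ℝ) else 1) * (A.card - 2) ≤
          (N / 2 - 1) * (W x).card)
      (ih : ∀ x ∈ A, IsSpread N (A.erase x) (m' x)) : IsSpread N A m

theorem IsSpread.transportBound (hN : 2 ≤ N) {m : Equiv.Perm V → ℝ} (h : IsSpread N A m) :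
    TransportBound N A m := by
  induction h with
  | small h => exact transportBound_of_card_le (by linarith) h
  | step hA hW h hspread _ ih => exact transportBound_of_split hN hA hW h hspread ih

end LevelStep

/-! ### Chains of splittings and conjugation -/

section Chains

variable {V : Type*} {A : Finset V}

lemma FixesOff.mono {B : Finset V} {g : Equiv.Perm V} (h : FixesOff A g) (hAB : A ⊆ B) :
    FixesOff B g := fun v hv => h v fun h0 => hv (hAB h0)

lemma FixesOff.one : FixesOff A (1 : Equiv.Perm V) := fun _ _ => rfl

lemma FixesOff.mul {g h : Equiv.Perm V} (hg : FixesOff A g) (hh : FixesOff A h) :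
    FixesOff A (g * h) := fun v hv => by rw [Equiv.Perm.mul_apply, hh v hv, hg v hv]

lemma FixesOff.inv {g : Equiv.Perm V} (hg : FixesOff A g) : FixesOff A g⁻¹ := fun v hv => by
  rw [Equiv.Perm.inv_eq_iff_eq, hg v hv]

variable [DecidableEq V]

lemma FixesOff.swap {a b : V} (ha : a ∈ A) (hb : b ∈ A) : FixesOff A (Equiv.swap a b) :=
  fun v hv => Equiv.swap_apply_of_ne_of_ne (by rintro rfl; exact hv ha) (by rintro rfl; exact hv hb)

/-- `m` is invariant under conjugation by permutations supported in `A`. -/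
def ConjInvOn (A : Finset V) (m : Equiv.Perm V → ℝ) : Prop :=
  ∀ w : Equiv.Perm V, FixesOff A w → ∀ X, m (w * X * w⁻¹) = m X

omit [DecidableEq V] in
lemma FixesOff.map_eq {g : Equiv.Perm V} (hg : FixesOff A g) : A.map g.toEmbedding = A := by
  ext v
  rw [Finset.mem_map_equiv]
  exact hg.inv.mem_iff v

variable [Fintype V]

lemma Split.conj {m m' : Equiv.Perm V → ℝ} {x : V} {q : V → ℝ} {u : V → Equiv.Perm V}
    (h : Split A m x q m' u) (g : Equiv.Perm V) :
    Split (A.map g.toEmbedding) (fun X => m (g⁻¹ * X * g)) (g x) (fun i => q (g⁻¹ i))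
      (fun ρ => m' (g⁻¹ * ρ * g)) (fun i => g * u (g⁻¹ i) * g⁻¹) := by
  have hmem : ∀ v, v ∈ A.map g.toEmbedding ↔ g⁻¹ v ∈ A := fun v => Finset.mem_map_equiv
  have hfix : ∀ {B : Finset V} {ρ : Equiv.Perm V}, FixesOff B ρ →
      ∀ v, g⁻¹ v ∉ B → g (ρ (g⁻¹ v)) = v := by
    intro B ρ hρ v hv
    rw [hρ _ hv]; simp
  refine ⟨⟨fun i => h.q_pr.nonneg _, ?_⟩, ?_, ⟨fun i => h.m'_pr.nonneg _, ?_⟩, ?_, ?_, ?_, ?_⟩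
  · rw [← h.q_pr.sum_one]; exact Equiv.sum_comp g⁻¹ q
  · intro i hi
    exact h.q_off _ fun h0 => hi ((hmem i).2 h0)
  · rw [← h.m'_pr.sum_one]
    have := Equiv.sum_comp (MulAut.conj g⁻¹).toEquiv m'
    rw [← this]
    exact Finset.sum_congr rfl fun ρ _ => by simp
  · intro ρ hρ v hv
    have h1 := h.m'_off _ hρ (g⁻¹ v) (by
      rw [Finset.mem_erase, ← hmem]
      rintro ⟨h1, h2⟩
      exact hv (Finset.mem_erase.2 ⟨fun h0 => h1 (by rw [h0]; simp), h2⟩))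
    simpa using h1
  · intro i; simp [h.u_base]
  · intro i hi v hv
    exact hfix (h.u_off _ ((hmem i).1 hi)) v fun h0 => hv ((hmem v).2 h0)
  · intro X
    have := h.eq (g⁻¹ * X * g)
    simp only [Equiv.Perm.mul_apply] at this
    rw [this]
    congr 2
    simp [mul_assoc]

lemma Split.conj_of_invariant {m m' : Equiv.Perm V → ℝ} {x : V} {q : V → ℝ}
    {u : V → Equiv.Perm V} (h : Split A m x q m' u) (hm : ConjInvOn A m) {g : Equiv.Perm V}
    (hg : FixesOff A g) :
    Split A m (g x) (fun i => q (g⁻¹ i))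
      (fun ρ => m' (g⁻¹ * ρ * g)) (fun i => g * u (g⁻¹ i) * g⁻¹) := by
  have := h.conj g
  rw [hg.map_eq] at this
  convert this using 1
  funext X
  have := hm g⁻¹ hg.inv X
  rwa [inv_inv, eq_comm] at this

lemma Split.translate {m m' : Equiv.Perm V → ℝ} {x : V} {q : V → ℝ} {u : V → Equiv.Perm V}
    (h : Split A m x q m' u) {v : Equiv.Perm V} (hv : FixesOff A v) :
    Split A (fun X => m (v⁻¹ * X)) x (fun i => q (v⁻¹ i)) m' (fun i => v * u (v⁻¹ i)) := by
  refine ⟨⟨fun i => h.q_pr.nonneg _, ?_⟩, ?_, h.m'_pr, h.m'_off, ?_, ?_, ?_⟩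
  · rw [← h.q_pr.sum_one]; exact Equiv.sum_comp v⁻¹ q
  · intro i hi; exact h.q_off _ (by rwa [hv.inv.mem_iff])
  · intro i; simp [h.u_base]
  · intro i hi; exact hv.mul (h.u_off _ (by rwa [hv.inv.mem_iff]))
  · intro X
    have := h.eq (v⁻¹ * X)
    simp only [Equiv.Perm.mul_apply] at this
    rw [this]
    simp [mul_assoc]

/-- Iterated splittings of a measure; when `s` holds, the translating permutations are normalized
and move at most `ℓ` points. -/
inductive SplitChain (s : Prop) (ℓ : ℕ) : Finset V → (Equiv.Perm V → ℝ) → Prop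
  | nil (m : Equiv.Perm V → ℝ) : SplitChain s ℓ ∅ m
  | step {A : Finset V} {m m' : Equiv.Perm V → ℝ} {x : V} {q : V → ℝ} {u : V → Equiv.Perm V}
      (hx : x ∈ A) (h : Split A m x q m' u)
      (hs : s → u x = 1 ∧ ∀ i ∈ A, (u i).support.card ≤ ℓ)
      (ih : SplitChain s ℓ (A.erase x) m') : SplitChain s ℓ A m

variable {ℓ : ℕ} {s : Prop} {m : Equiv.Perm V → ℝ}

lemma SplitChain.weaken (h : SplitChain s ℓ A m) : SplitChain False ℓ A m := by
  induction h with
  | nil m => exact .nil m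
  | step hx h _ _ ih => exact .step hx h False.elim ih

lemma SplitChain.conj (h : SplitChain s ℓ A m) (g : Equiv.Perm V) :
    SplitChain s ℓ (A.map g.toEmbedding) (fun X => m (g⁻¹ * X * g)) := by
  induction h with
  | nil m => exact .nil _
  | @step A m m' x q u hx h hs _ ih =>
    refine .step (x := g x) ?_ (h.conj g) (fun h0 => ⟨?_, fun i hi => ?_⟩) ?_
    · rw [Finset.mem_map_equiv]; simpa using hx
    · simp [(hs h0).1]
    · rw [Equiv.Perm.card_support_conj]
      exact (hs h0).2 _ (by rwa [Finset.mem_map_equiv] at hi)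
    · rwa [Finset.map_erase] at ih

lemma SplitChain.translate (h : SplitChain False ℓ A m) {v : Equiv.Perm V} (hv : FixesOff A v) :
    SplitChain False ℓ A (fun X => m (v⁻¹ * X)) := by
  cases h with
  | nil m => exact .nil _
  | step hx h _ ih => exact .step hx (h.translate hv) False.elim ih

/-- An invariant measure with a chain of splittings can be split at an arbitrary point. -/
lemma SplitChain.exists_split (h : SplitChain s ℓ A m) (hm : ConjInvOn A m) {x : V} (hx : x ∈ A) :
    ∃ (q : V → ℝ) (m' : Equiv.Perm V → ℝ) (u : V → Equiv.Perm V), Split A m x q m' u ∧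
      (s → u x = 1 ∧ ∀ i ∈ A, (u i).support.card ≤ ℓ) ∧ SplitChain s ℓ (A.erase x) m' := by
  cases h with
  | nil m => simp at hx
  | @step A m m' x₀ q u hx₀ h hs ih =>
    set g := Equiv.swap x₀ x with hg
    have hgA : FixesOff A g := FixesOff.swap hx₀ hx
    have hgx : g x₀ = x := Equiv.swap_apply_left _ _
    have h1 := h.conj_of_invariant hm hgA
    have h2 := ih.conj g
    rw [Finset.map_erase, hgA.map_eq] at h2
    simp only [Equiv.coe_toEmbedding] at h2
    rw [hgx] at h1 h2
    refine ⟨_, _, _, h1, fun h0 => ⟨?_, fun i hi => ?_⟩, h2⟩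
    · rw [← hgx]; simp [(hs h0).1]
    · rw [Equiv.Perm.card_support_conj]
      exact (hs h0).2 _ (by rwa [hgA.inv.mem_iff])

end Chains

/-! ### Rigidity of fixed point free splittings -/

section Rigidity

variable {V : Type*} [DecidableEq V]

lemma exists_fixesOff_map_pair {Q : Finset V} {a b c d i : V} (ha : a ∈ Q) (hb : b ∈ Q) (hc : c ∈ Q)
    (hd : d ∈ Q) (hab : a ≠ b) (hcd : c ≠ d) (hai : a ≠ i) (hbi : b ≠ i) (hci : c ≠ i)
    (hdi : d ≠ i) : ∃ g : Equiv.Perm V, FixesOff Q g ∧ g i = i ∧ g a = c ∧ g b = d := by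
  have h1 : FixesOff Q (Equiv.swap a c) := FixesOff.swap ha hc
  have hb' : Equiv.swap a c b ∈ Q := (h1.mem_iff b).2 hb
  have hi : Equiv.swap a c i = i := Equiv.swap_apply_of_ne_of_ne hai.symm hci.symm
  refine ⟨Equiv.swap (Equiv.swap a c b) d * Equiv.swap a c, (FixesOff.swap hb' hd).mul h1, ?_, ?_, ?_⟩
  · rw [Equiv.Perm.mul_apply, hi]
    refine Equiv.swap_apply_of_ne_of_ne (fun h => hbi ?_) hdi.symm
    rw [← hi] at h
    exact ((Equiv.swap a c).injective h).symm
  · rw [Equiv.Perm.mul_apply, Equiv.swap_apply_left]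
    refine Equiv.swap_apply_of_ne_of_ne (fun h => hab ?_) hcd
    rw [← Equiv.swap_apply_left a c] at h
    exact (Equiv.swap a (Equiv.swap a c a)).injective (by simpa using h)
  · simp

lemma apply_pair_of_fixes {c : Equiv.Perm V} {i j : V} (hij : i ≠ j)
    (h : ∀ v, v ≠ i → v ≠ j → c v = v) : c i = i ∧ c j = j ∨ c i = j ∧ c j = i := by
  have hi : c i = i ∨ c i = j := by
    by_contra! h0
    exact h0.1 (c.injective (h _ h0.1 h0.2))
  have hj : c j = i ∨ c j = j := by
    by_contra! h0
    exact h0.2 (c.injective (h _ h0.1 h0.2))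
  have := c.injective.ne hij
  grind

lemma exists_mem_avoid {Q : Finset V} (s : Finset V) (h : s.card < Q.card) :
    ∃ v ∈ Q, v ∉ s := by
  by_contra! h0
  exact absurd (Finset.card_le_card h0) (by omega)

/-- A family of functions on the permutations of `Q`, indexed by the points of `Q` and equivariant
under conjugation, whose members are translates of each other and charge only permutations with at
most one prescribed fixed point, is constant. -/
lemma equivariant_translates_eq {Q : Finset V} (hQ : 6 ≤ Q.card) {M : V → Equiv.Perm V → ℝ}
    {s : V → Equiv.Perm V} {f : Equiv.Perm V → ℝ} (hs : ∀ i ∈ Q, FixesOff Q (s i))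
    (hMs : ∀ i Y, M i Y = f ((s i)⁻¹ * Y)) {Y₀ : Equiv.Perm V} (hf : f Y₀ ≠ 0)
    (hoff : ∀ i ∈ Q, ∀ Y, M i Y ≠ 0 → FixesOff Q Y)
    (hcov : ∀ w : Equiv.Perm V, FixesOff Q w → ∀ i ∈ Q, ∀ Y, M (w i) (w * Y * w⁻¹) = M i Y)
    (hfree : ∀ i ∈ Q, ∀ Y, M i Y ≠ 0 → ∀ v ∈ Q, v ≠ i → Y v ≠ v) {i j : V} (hi : i ∈ Q)
    (hj : j ∈ Q) : M i = M j := by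
  have hconj : ∀ i ∈ Q, ∀ r : Equiv.Perm V, (∀ Y, M i (r * Y) = M i Y) → ∀ w : Equiv.Perm V,
      FixesOff Q w → w i = i → ∀ Y, M i (w * r * w⁻¹ * Y) = M i Y := by
    intro i hi r hr w hw hwi Y
    have h1 := hcov w hw i hi (r * (w⁻¹ * Y * w))
    have h2 := hcov w hw i hi (w⁻¹ * Y * w)
    rw [hwi] at h1 h2
    rw [hr, ← h2] at h1
    simpa [mul_assoc] using h1
  have hmain : ∀ i ∈ Q, ∀ r : Equiv.Perm V, FixesOff Q r → (∀ Y, M i (r * Y) = M i Y) →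
      ∀ a ∈ Q, a ≠ i → r a ≠ i → r a = a := by
    intro i hi r hrQ hr a ha hai hrai
    by_contra hra
    set Y := s i * Y₀ with hY
    have hMY : M i Y ≠ 0 := by rw [hMs, hY, inv_mul_cancel_left]; exact hf
    have hYQ := hoff i hi Y hMY
    obtain ⟨v, hvQ, hv⟩ := exists_mem_avoid (Q := Q) {i, Y⁻¹ i}
      (lt_of_le_of_lt Finset.card_le_two (by omega))
    simp only [Finset.mem_insert, Finset.mem_singleton, not_or] at hv
    have hYv : Y v ≠ i := fun h => hv.2 (by rw [← h]; simp)
    obtain ⟨g, hgQ, hgi, hga, hgb⟩ := exists_fixesOff_map_pair ha ((hrQ.mem_iff a).2 ha)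
      ((hYQ.mem_iff v).2 hvQ) hvQ (Ne.symm hra) (hfree i hi Y hMY v hvQ hv.1) hai hrai hYv hv.1
    have h1 := hconj i hi r hr g hgQ hgi Y
    refine hfree i hi _ (by rw [h1]; exact hMY) v hvQ hv.1 ?_
    have : g⁻¹ (Y v) = a := by rw [← hga]; simp
    simp only [Equiv.Perm.mul_apply]
    rw [this, hgb]
  have hrigid : ∀ i ∈ Q, ∀ r : Equiv.Perm V, FixesOff Q r → (∀ Y, M i (r * Y) = M i Y) → r = 1 := by
    intro i hi r hrQ hr
    have hall : ∀ v, v ≠ i → r v = v := by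
      intro v hvi
      by_cases hvQ : v ∈ Q
      swap
      · exact hrQ v hvQ
      by_cases hrv : r v = i
      swap
      · exact hmain i hi r hrQ hr v hvQ hvi hrv
      exfalso
      obtain ⟨v', hvQ', hv'⟩ := exists_mem_avoid (Q := Q) {i, v}
        (lt_of_le_of_lt Finset.card_le_two (by omega))
      simp only [Finset.mem_insert, Finset.mem_singleton, not_or] at hv'
      set w := Equiv.swap v v' with hw
      have hwQ : FixesOff Q w := FixesOff.swap hvQ hvQ'
      have hwi : w i = i := Equiv.swap_apply_of_ne_of_ne hvi.symm (Ne.symm hv'.1)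
      have h1 := hconj i hi r hr w hwQ hwi
      have hrinv : ∀ Y, M i (r⁻¹ * Y) = M i Y := fun Y => by rw [← hr (r⁻¹ * Y), mul_inv_cancel_left]
      have hwv : w⁻¹ v' = v := by simp [hw]
      have hrv' : r⁻¹ i = v := by rw [← hrv]; simp
      have h2 : (r⁻¹ * (w * r * w⁻¹)) v' = v := by
        simp only [Equiv.Perm.mul_apply]
        rw [hwv, hrv, hwi, hrv']
      have h3 := hmain i hi (r⁻¹ * (w * r * w⁻¹)) (hrQ.inv.mul ((hwQ.mul hrQ).mul hwQ.inv))
        (fun Y => by rw [mul_assoc, hrinv, h1]) v' hvQ' hv'.1 (by rw [h2]; exact hvi)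
      rw [h2] at h3
      exact hv'.2 h3.symm
    ext v
    by_cases hvi : v = i
    · subst hvi
      by_contra h0
      exact h0 (r.injective (hall _ h0))
    · exact hall v hvi
  set c : V → V → Equiv.Perm V := fun i j => s j * (s i)⁻¹ with hc
  have hcQ : ∀ i ∈ Q, ∀ j ∈ Q, FixesOff Q (c i j) := fun i hi j hj => (hs j hj).mul (hs i hi).inv
  have hcM : ∀ i j Y, M j (c i j * Y) = M i Y := fun i j Y => by
    rw [hMs, hMs, hc]; simp [mul_assoc]
  have hcomm : ∀ i ∈ Q, ∀ j ∈ Q, ∀ w, FixesOff Q w → w i = i → w j = j →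
      ∀ v, w (c i j v) = c i j (w v) := by
    intro i hi j hj w hw hwi hwj v
    have h1 : w * c i j * w⁻¹ * (c i j)⁻¹ = 1 := by
      refine hrigid j hj _ (((hw.mul (hcQ i hi j hj)).mul hw.inv).mul (hcQ i hi j hj).inv) fun Y => ?_
      have e1 := hcov w hw j hj (c i j * (w⁻¹ * ((c i j)⁻¹ * Y) * w))
      have e2 := hcov w hw i hi (w⁻¹ * ((c i j)⁻¹ * Y) * w)
      rw [hwj, hcM, ← e2, hwi] at e1
      have e3 := hcM i j ((c i j)⁻¹ * Y)
      rw [mul_inv_cancel_left] at e3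
      rw [e3]
      simpa [mul_assoc] using e1
    have h2 : w * c i j = c i j * w := by
      rw [mul_inv_eq_one, mul_inv_eq_iff_eq_mul] at h1; exact h1
    exact congrArg (fun g : Equiv.Perm V => g v) h2
  have hcfix : ∀ i ∈ Q, ∀ j ∈ Q, ∀ v, v ≠ i → v ≠ j → c i j v = v := by
    intro i hi j hj v hvi hvj
    by_cases hvQ : v ∈ Q
    swap
    · exact hcQ i hi j hj v hvQ
    by_contra hz
    set z := c i j v with hzdef
    have hzQ : z ∈ Q := ((hcQ i hi j hj).mem_iff v).2 hvQ
    obtain ⟨z', hzQ', hz'⟩ := exists_mem_avoid (Q := Q) {i, j, v, z}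
      (lt_of_le_of_lt Finset.card_le_four (by omega))
    simp only [Finset.mem_insert, Finset.mem_singleton, not_or] at hz'
    have hw : FixesOff Q (Equiv.swap v z') := FixesOff.swap hvQ hzQ'
    have h1 := hcomm i hi j hj _ hw (Equiv.swap_apply_of_ne_of_ne (Ne.symm hvi) (Ne.symm hz'.1))
      (Equiv.swap_apply_of_ne_of_ne (Ne.symm hvj) (Ne.symm hz'.2.1)) v
    rw [← hzdef, Equiv.swap_apply_left,
      Equiv.swap_apply_of_ne_of_ne hz (Ne.symm hz'.2.2.2)] at h1
    exact hz'.2.2.1 ((c i j).injective h1.symm)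
  have hcoc : ∀ i j k v, c j k (c i j v) = c i k v := fun i j k v => by simp [hc]
  by_cases hij : i = j
  · rw [hij]
  have hone : c i j = 1 := by
    have hfix := hcfix i hi j hj
    have hij2 : c i j i = i ∧ c i j j = j := by
      rcases apply_pair_of_fixes hij hfix with h | ⟨h1, h2⟩
      · exact h
      exfalso
      obtain ⟨k, hk, hk'⟩ := exists_mem_avoid (Q := Q) {i, j}
        (lt_of_le_of_lt Finset.card_le_two (by omega))
      simp only [Finset.mem_insert, Finset.mem_singleton, not_or] at hk'
      have e1 := hcoc i j k j
      rw [h2, hcfix j hj k hk i hij (Ne.symm hk'.1),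
        hcfix i hi k hk j (Ne.symm hij) (Ne.symm hk'.2)] at e1
      exact hij e1
    ext v
    by_cases hvi : v = i
    · rw [hvi]; exact hij2.1
    by_cases hvj : v = j
    · rw [hvj]; exact hij2.2
    exact hfix v hvi hvj
  funext Y
  rw [← hcM i j Y, hone, one_mul]

end Rigidity

section FixedPointFree

variable {V : Type*} [Fintype V] [DecidableEq V] {A : Finset V} {m m' : Equiv.Perm V → ℝ} {x : V}
  {q : V → ℝ} {u : V → Equiv.Perm V} {ℓ : ℕ} {N : ℝ}

lemma IsPr.exists_ne_zero {X : Type*} [Fintype X] {p : X → ℝ} (h : IsPr p) : ∃ x, p x ≠ 0 := by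
  by_contra! h0
  have := h.sum_one
  simp [h0] at this

lemma Split.weight_invariant (h : Split A m x q m' u) (hm : ConjInvOn A m) {w : Equiv.Perm V}
    (hw : FixesOff (A.erase x) w) (i : V) : q (w i) = q i := by
  have hwx : w x = x := hw x (by simp)
  have h1 := h.conj_of_invariant hm (hw.mono (Finset.erase_subset _ _))
  rw [hwx] at h1
  rw [← h.mg_eq (w i), h1.mg_eq]
  simp

lemma Split.exists_swap_split (hx : x ∈ A) (hA : 7 ≤ A.card) (h : Split A m x q m' u)
    (hch : SplitChain False ℓ (A.erase x) m') (hm : ConjInvOn A m)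
    (hfree : ∀ X, m X ≠ 0 → ∀ a ∈ A, X a ≠ a) :
    ∃ m'' : Equiv.Perm V → ℝ, Split A m x q m'' (fun i => Equiv.swap i x) ∧
      SplitChain False ℓ (A.erase x) m'' ∧ ConjInvOn (A.erase x) m'' ∧
      ∀ X, m'' X ≠ 0 → ∀ a ∈ A.erase x, X a ≠ a := by
  set Q := A.erase x with hQdef
  have hQcard : 6 ≤ Q.card := by rw [hQdef, Finset.card_erase_of_mem hx]; omega
  have hxQ : x ∉ Q := by simp [hQdef]
  have hQA : Q ⊆ A := Finset.erase_subset _ _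
  set s : V → Equiv.Perm V := fun i => Equiv.swap i x * u i with hsdef
  set M : V → Equiv.Perm V → ℝ := fun i Y => m' ((s i)⁻¹ * Y) with hMdef
  have hs : ∀ i ∈ Q, FixesOff Q (s i) := by
    intro i hi v hv
    by_cases hvx : v = x
    · rw [hvx]; simp [hsdef, h.u_base]
    · exact ((FixesOff.swap (hQA hi) hx).mul (h.u_off i (hQA hi))) v
        fun h0 => hv (Finset.mem_erase.2 ⟨hvx, h0⟩)
  obtain ⟨ρ₀, hρ₀⟩ := h.m'_pr.exists_ne_zero
  have hoff : ∀ i ∈ Q, ∀ Y, M i Y ≠ 0 → FixesOff Q Y := by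
    intro i hi Y hY
    have := (hs i hi).mul (h.m'_off _ hY)
    rwa [mul_inv_cancel_left] at this
  have hM : ∀ i Y, Y x = x → m (Equiv.swap i x * Y) = q i * M i Y := by
    intro i Y hY
    rw [h.eq]
    simp [hY, hMdef, hsdef, mul_assoc]
  have hqx : q x = 0 := by
    by_contra h0
    have h1 : m (u x * ρ₀) ≠ 0 := by
      rw [h.apply_mul (h.m'_off _ hρ₀ x hxQ)]; exact mul_ne_zero h0 hρ₀
    refine hfree _ h1 x hx ?_
    rw [Equiv.Perm.mul_apply, h.m'_off _ hρ₀ x hxQ, h.u_base]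
  have hqoff : ∀ i, i ∉ Q → q i = 0 := by
    intro i hi
    by_cases hix : i = x
    · rw [hix, hqx]
    · exact h.q_off i fun h0 => hi (Finset.mem_erase.2 ⟨hix, h0⟩)
  have hqne : ∀ i ∈ Q, q i ≠ 0 := by
    intro i hi h0
    obtain ⟨j, hj⟩ := h.q_pr.exists_ne_zero
    have hjQ : j ∈ Q := by by_contra h1; exact hj (hqoff j h1)
    have := h.weight_invariant hm (FixesOff.swap hi hjQ) i
    rw [Equiv.swap_apply_left, h0] at this
    exact hj this
  have hcov : ∀ w : Equiv.Perm V, FixesOff Q w → ∀ i ∈ Q, ∀ Y, M (w i) (w * Y * w⁻¹) = M i Y := by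
    intro w hw i hi Y
    have hwx : w x = x := hw x hxQ
    have hwx' : w⁻¹ x = x := hw.inv x hxQ
    by_cases hY : Y x = x
    · have h1 := hM (w i) (w * Y * w⁻¹) (by simp only [Equiv.Perm.mul_apply]; rw [hwx', hY, hwx])
      have h2 := hm w (hw.mono hQA) (Equiv.swap i x * Y)
      have h3 : w * (Equiv.swap i x * Y) * w⁻¹ = Equiv.swap (w i) x * (w * Y * w⁻¹) := by
        have := Equiv.swap_apply_apply w i x
        rw [hwx] at this
        rw [this]; simp [mul_assoc]
      rw [h3, h1, hM i Y hY, h.weight_invariant hm hw] at h2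
      exact mul_left_cancel₀ (hqne i hi) h2
    · have e1 : M i Y = 0 := by
        by_contra h0; exact hY (hoff i hi Y h0 x hxQ)
      have e2 : M (w i) (w * Y * w⁻¹) = 0 := by
        by_contra h0
        have := hoff (w i) ((hw.mem_iff i).2 hi) _ h0 x hxQ
        simp only [Equiv.Perm.mul_apply] at this
        rw [hwx', ← hwx] at this
        exact hY (by rw [hwx] at this; exact w.injective (this.trans hwx.symm))
      rw [e1, e2]
  have hfreeM : ∀ i ∈ Q, ∀ Y, M i Y ≠ 0 → ∀ v ∈ Q, v ≠ i → Y v ≠ v := by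
    intro i hi Y hY v hv hvi hYv
    have h1 := hM i Y (hoff i hi Y hY x hxQ)
    refine hfree _ (by rw [h1]; exact mul_ne_zero (hqne i hi) hY) v (hQA hv) ?_
    rw [Equiv.Perm.mul_apply, hYv]
    exact Equiv.swap_apply_of_ne_of_ne hvi fun h0 => hxQ (h0 ▸ hv)
  have heq : ∀ i ∈ Q, ∀ j ∈ Q, M i = M j := fun i hi j hj =>
    equivariant_translates_eq hQcard hs (fun _ _ => rfl) hρ₀ hoff hcov hfreeM hi hj
  obtain ⟨i₀, hi₀⟩ : Q.Nonempty := Finset.card_pos.1 (by omega)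
  refine ⟨M i₀, ⟨h.q_pr, h.q_off, ⟨fun ρ => h.m'_pr.nonneg _, ?_⟩, hoff i₀ hi₀, fun i => by simp,
    fun i hi => FixesOff.swap hi hx, fun X => ?_⟩, hch.translate (hs i₀ hi₀), fun w hw X => ?_,
    fun X hX a ha => ?_⟩
  · rw [← h.m'_pr.sum_one]; exact Equiv.sum_comp (Equiv.mulLeft (s i₀)⁻¹) m'
  · by_cases hi : X x ∈ Q
    · rw [heq i₀ hi₀ _ hi, h.eq X]
      simp [hMdef, hsdef, mul_assoc]
    · rw [h.eq X, hqoff _ hi, zero_mul, zero_mul]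
  · rw [← hcov w hw i₀ hi₀ X, heq _ ((hw.mem_iff i₀).2 hi₀) _ hi₀]
  · obtain ⟨j, hj, hja⟩ := exists_mem_avoid (Q := Q) {a} (by simp; omega)
    rw [heq i₀ hi₀ j hj] at hX
    exact hfreeM j hj X hX a ha fun h0 => hja (by simp [h0])

omit [Fintype V] [DecidableEq V] in
lemma card_ge_of_large (hN : 2 ≤ N) (hA : N * (N + 1) < A.card) : 7 ≤ A.card := by
  have : (6 : ℝ) < A.card := by nlinarith
  have : 6 < A.card := by exact_mod_cast this
  omega

lemma SplitChain.isSpread_of_free (hN : 2 ≤ N) (hch : SplitChain False ℓ A m) (hm : ConjInvOn A m)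
    (hfree : ∀ X, m X ≠ 0 → ∀ a ∈ A, X a ≠ a) : IsSpread N A m := by
  induction hk : A.card generalizing A m with
  | zero => exact .small (by rw [hk]; push_cast; nlinarith)
  | succ k ih =>
    by_cases hA : (A.card : ℝ) ≤ N * (N + 1)
    · exact .small hA
    push Not at hA
    have hstep : ∀ x, ∃ (q : V → ℝ) (m'' : Equiv.Perm V → ℝ), x ∈ A →
        Split A m x q m'' (fun i => Equiv.swap i x) ∧ IsSpread N (A.erase x) m'' := by
      intro x
      by_cases hx : x ∈ A
      · obtain ⟨q, m', u, h, -, hch'⟩ := hch.exists_split hm hx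
        obtain ⟨m'', h1, h2, h3, h4⟩ :=
          h.exists_swap_split hx (card_ge_of_large hN hA) hch' hm hfree
        exact ⟨q, m'', fun _ => ⟨h1, ih h2 h3 h4 (by rw [Finset.card_erase_of_mem hx, hk]; rfl)⟩⟩
      · exact ⟨fun _ => 0, fun _ => 0, fun h => absurd h hx⟩
    choose q m'' hqm using hstep
    refine .step (q := q) (m' := m'') (W := fun _ => {1}) (u := fun x _ i => Equiv.swap i x) hA
      (fun x _ => by simp) (fun x hx _ _ => (hqm x hx).1) ?_ fun x hx => (hqm x hx).2
    intro x _ i _ l _ hlx hli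
    simp only [Finset.sum_singleton]
    rw [Equiv.swap_apply_of_ne_of_ne hli hlx]
    simp
    linarith

end FixedPointFree

/-! ### Invariant measures with short translating permutations -/

section InvariantChains

variable {V : Type*} [Fintype V] [DecidableEq V] {A : Finset V} {m m' : Equiv.Perm V → ℝ} {x : V}
  {q : V → ℝ} {u : V → Equiv.Perm V} {ℓ : ℕ} {N : ℝ}

lemma Split.conjInvOn (h : Split A m x q m' u) (hm : ConjInvOn A m) (hux : u x = 1)
    (hqx : q x ≠ 0) : ConjInvOn (A.erase x) m' := by
  intro w hw X
  have hwx : w x = x := hw x (by simp)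
  have hwx' : w⁻¹ x = x := hw.inv x (by simp)
  have key : ∀ ρ : Equiv.Perm V, ρ x = x → m ρ = q x * m' ρ := fun ρ hρ => by
    rw [h.eq, hρ, hux]; simp
  by_cases hX : X x = x
  · have h1 := hm w (hw.mono (Finset.erase_subset _ _)) X
    rw [key X hX, key (w * X * w⁻¹) (by simp only [Equiv.Perm.mul_apply]; rw [hwx', hX, hwx])] at h1
    exact mul_left_cancel₀ hqx h1
  · rw [h.m'_apply hX, h.m'_apply]
    simp only [Equiv.Perm.mul_apply]
    rw [hwx']
    intro h0
    exact hX (w.injective (h0.trans hwx.symm))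

lemma Split.conj_base (h : Split A m x q m' u) (hm : ConjInvOn A m)
    (hm' : ConjInvOn (A.erase x) m') {g : Equiv.Perm V} (hg : FixesOff (A.erase x) g) :
    Split A m x q m' (fun i => g * u (g⁻¹ i) * g⁻¹) := by
  have h1 := h.conj_of_invariant hm (hg.mono (Finset.erase_subset _ _))
  rw [hg x (by simp)] at h1
  have e1 : (fun i => q (g⁻¹ i)) = q := funext fun i => h.weight_invariant hm hg.inv i
  have e2 : (fun ρ => m' (g⁻¹ * ρ * g)) = m' := funext fun ρ => by
    have := hm' g⁻¹ hg.inv ρ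
    rwa [inv_inv] at this
  rwa [e1, e2] at h1

/-- Averaging over conjugates, short translating permutations move every label rarely. -/
lemma sum_conj_moves_le (hu : ∀ i, u i x = i) (hux : u x = 1) (hℓ : 2 ≤ ℓ) (hx : x ∈ A)
    (hdeg : ∀ i ∈ A, (u i).support.card ≤ ℓ) {i l : V} (hi : i ∈ A) (hl : l ∈ A) (hlx : l ≠ x)
    (hli : l ≠ i) :
    (∑ g ∈ Finset.univ.filter (FixesOff (A.erase x)),
      if (g * u (g⁻¹ i) * g⁻¹ : Equiv.Perm V) l = l then (0 : ℝ) else 1) * (A.card - 2) ≤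
      ((ℓ : ℝ) - 2) * (Finset.univ.filter (FixesOff (A.erase x))).card := by
  have hℓ' : (0 : ℝ) ≤ ℓ - 2 := by
    have : (2 : ℝ) ≤ ℓ := by exact_mod_cast hℓ
    linarith
  set W := (Finset.univ.filter (FixesOff (A.erase x)) : Finset (Equiv.Perm V)) with hW
  have hWmem : ∀ g, g ∈ W ↔ FixesOff (A.erase x) g := fun g => by simp [hW]
  set t : Equiv.Perm V → Equiv.Perm V := fun g => g * u (g⁻¹ i) * g⁻¹ with ht
  by_cases hix : i = x
  · have h0 : ∀ g ∈ W, (if t g l = l then (0 : ℝ) else 1) = 0 := by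
      intro g hg
      have : g⁻¹ x = x := ((hWmem g).1 hg).inv x (by simp)
      simp only [ht, hix, this, hux]
      simp
    rw [Finset.sum_eq_zero h0, zero_mul]
    positivity
  set B := (A.erase x).erase i with hB
  have hiQ : i ∈ A.erase x := Finset.mem_erase.2 ⟨hix, hi⟩
  have hBcard : (B.card : ℝ) = A.card - 2 := by
    rw [hB, Finset.card_erase_of_mem hiQ, Finset.card_erase_of_mem hx]
    have h2 : 2 ≤ A.card := Finset.one_lt_card.2 ⟨i, hi, x, hx, hix⟩
    rw [Nat.sub_sub, Nat.cast_sub h2]; norm_num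
  have hsym : ∀ l' ∈ B, ∑ g ∈ W, (if t g l' = l' then (0 : ℝ) else 1) =
      ∑ g ∈ W, (if t g l = l then (0 : ℝ) else 1) := by
    intro l' hl'
    simp only [hB, Finset.mem_erase] at hl'
    set s := Equiv.swap l l' with hs
    have hsQ : FixesOff (A.erase x) s := FixesOff.swap (Finset.mem_erase.2 ⟨hlx, hl⟩)
      (Finset.mem_erase.2 ⟨hl'.2.1, hl'.2.2⟩)
    have hsi : s i = i := Equiv.swap_apply_of_ne_of_ne hli.symm (Ne.symm hl'.1)
    have hsi' : s⁻¹ i = i := by rw [Equiv.Perm.inv_eq_iff_eq, hsi]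
    have hsl : s l = l' := Equiv.swap_apply_left _ _
    have hsl' : s⁻¹ l' = l := by rw [Equiv.Perm.inv_eq_iff_eq, hsl]
    refine (Finset.sum_bij' (fun g _ => s * g) (fun g _ => s⁻¹ * g) ?_ ?_ ?_ ?_ ?_).symm
    · intro g hg; rw [hWmem] at hg ⊢; exact hsQ.mul hg
    · intro g hg; rw [hWmem] at hg ⊢; exact hsQ.inv.mul hg
    · intro g _; simp
    · intro g _; simp
    · intro g _
      have e : t (s * g) = s * t g * s⁻¹ := by
        have : (s * g)⁻¹ i = g⁻¹ i := by
          rw [mul_inv_rev, Equiv.Perm.mul_apply, hsi']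
        simp only [ht]
        rw [this]
        simp only [mul_inv_rev, mul_assoc]
      have e2 : t (s * g) l' = l' ↔ t g l = l := by
        rw [e]
        simp only [Equiv.Perm.mul_apply]
        rw [hsl', ← hsl, s.injective.eq_iff]
      simp only [e2]
  have hrow : ∀ g ∈ W, ∑ l' ∈ B, (if t g l' = l' then (0 : ℝ) else 1) ≤ (ℓ : ℝ) - 2 := by
    intro g hg
    have hgQ := (hWmem g).1 hg
    have hgx : g x = x := hgQ x (by simp)
    have hgx' : g⁻¹ x = x := hgQ.inv x (by simp)
    have htx : t g x = i := by
      simp only [ht, Equiv.Perm.mul_apply]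
      rw [hgx', hu]; simp
    have hcard : (t g).support.card ≤ ℓ := by
      rw [ht, Equiv.Perm.card_support_conj]
      exact hdeg _ ((hgQ.mono (Finset.erase_subset _ _)).inv.mem_iff i |>.2 hi)
    have hxs : x ∈ (t g).support := by rw [Equiv.Perm.mem_support, htx]; exact hix
    have his : i ∈ (t g).support := by
      rw [Equiv.Perm.mem_support]
      intro h0
      exact hix ((t g).injective (h0.trans htx.symm))
    have hsub : B.filter (fun l' => ¬ t g l' = l') ⊆ ((t g).support.erase x).erase i := by
      intro l' hl'
      simp only [hB, Finset.mem_filter, Finset.mem_erase] at hl'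
      simp only [Finset.mem_erase, Equiv.Perm.mem_support]
      exact ⟨hl'.1.1, hl'.1.2.1, hl'.2⟩
    have h1 := Finset.card_le_card hsub
    rw [Finset.card_erase_of_mem (Finset.mem_erase.2 ⟨hix, his⟩), Finset.card_erase_of_mem hxs] at h1
    have h2 : (B.filter (fun l' => ¬ t g l' = l')).card + 2 ≤ ℓ := by omega
    have h3 : ((B.filter (fun l' => ¬ t g l' = l')).card : ℝ) + 2 ≤ ℓ := by exact_mod_cast h2
    rw [Finset.card_filter] at h3
    push_cast at h3
    have h4 : ∀ l' ∈ B, (if t g l' = l' then (0 : ℝ) else 1) = if ¬ t g l' = l' then 1 else 0 :=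
      fun l' _ => by split_ifs <;> simp_all
    rw [Finset.sum_congr rfl h4]
    linarith
  calc (∑ g ∈ W, if t g l = l then (0 : ℝ) else 1) * (A.card - 2)
      = ∑ l' ∈ B, ∑ g ∈ W, (if t g l' = l' then (0 : ℝ) else 1) := by
        rw [Finset.sum_congr rfl hsym, Finset.sum_const, nsmul_eq_mul, hBcard, mul_comm]
    _ = ∑ g ∈ W, ∑ l' ∈ B, (if t g l' = l' then (0 : ℝ) else 1) := Finset.sum_comm
    _ ≤ ∑ g ∈ W, ((ℓ : ℝ) - 2) := Finset.sum_le_sum hrow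
    _ = _ := by rw [Finset.sum_const, nsmul_eq_mul, mul_comm]

theorem SplitChain.isSpread (hℓ : 2 ≤ ℓ) (hN : N = 2 * ((ℓ : ℝ) - 1))
    (hch : SplitChain True ℓ A m) (hm : ConjInvOn A m) : IsSpread N A m := by
  have hN2 : 2 ≤ N := by
    have : (2 : ℝ) ≤ ℓ := by exact_mod_cast hℓ
    linarith
  induction hk : A.card generalizing A m with
  | zero => exact .small (by rw [hk]; push_cast; nlinarith)
  | succ k ih =>
    by_cases hA : (A.card : ℝ) ≤ N * (N + 1)
    · exact .small hA
    push Not at hA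
    by_cases hfree : ∀ X, m X ≠ 0 → ∀ a ∈ A, X a ≠ a
    · exact hch.weaken.isSpread_of_free hN2 hm hfree
    push Not at hfree
    obtain ⟨X₀, hX₀, a, ha, hXa⟩ := hfree
    have hstep : ∀ x, ∃ (q : V → ℝ) (m' : Equiv.Perm V → ℝ) (u : V → Equiv.Perm V), x ∈ A →
        Split A m x q m' u ∧ (u x = 1 ∧ ∀ i ∈ A, (u i).support.card ≤ ℓ) ∧
          ConjInvOn (A.erase x) m' ∧ SplitChain True ℓ (A.erase x) m' := by
      intro x
      by_cases hx : x ∈ A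
      · obtain ⟨q, m', u, h, hs, hch'⟩ := hch.exists_split hm hx
        refine ⟨q, m', u, fun _ => ⟨h, hs trivial, h.conjInvOn hm (hs trivial).1 ?_, hch'⟩⟩
        set w := Equiv.swap a x with hw
        have h1 := hm w (FixesOff.swap ha hx) X₀
        have h2 : (w * X₀ * w⁻¹) x = x := by
          have h3 : w⁻¹ x = a := by simp [hw]
          have h4 : w a = x := Equiv.swap_apply_left _ _
          simp only [Equiv.Perm.mul_apply]
          rw [h3, hXa, h4]
        rw [h.eq, h2] at h1
        intro h0
        rw [h0, zero_mul] at h1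
        exact hX₀ h1.symm
      · exact ⟨fun _ => 0, fun _ => 0, fun _ => 1, fun h => absurd h hx⟩
    choose q m' u hqm using hstep
    refine .step (q := q) (m' := m') (W := fun x => Finset.univ.filter (FixesOff (A.erase x)))
      (u := fun x g i => g * u x (g⁻¹ i) * g⁻¹) hA
      (fun x _ => ⟨1, by simpa using FixesOff.one⟩) ?_ ?_ fun x hx => ?_
    · intro x hx g hg
      exact (hqm x hx).1.conj_base hm (hqm x hx).2.2.1 (Finset.mem_filter.1 hg).2
    · intro x hx i hi l hl hlx hli
      have e : N / 2 - 1 = (ℓ : ℝ) - 2 := by rw [hN]; ring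
      rw [e]
      exact sum_conj_moves_le (hqm x hx).1.u_base (hqm x hx).2.1.1 hℓ hx (hqm x hx).2.1.2 hi hl hlx
        hli
    · exact ih (hqm x hx).2.2.2 (hqm x hx).2.2.1 (by rw [Finset.card_erase_of_mem hx, hk]; rfl)

end InvariantChains

/-! ### Measures in the class `M_T` as iterated splittings -/

section LocalBase

/-- The first `k` elements of `Fin n`. -/
def initSeg (n k : ℕ) : Finset (Fin n) := Finset.univ.filter fun l => (l : ℕ) < k

lemma mem_initSeg {n k : ℕ} {l : Fin n} : l ∈ initSeg n k ↔ (l : ℕ) < k := by simp [initSeg]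

lemma initSeg_succ_erase {n : ℕ} (k : Fin n) : (initSeg n (k + 1)).erase k = initSeg n k := by
  ext l
  rw [Finset.mem_erase, mem_initSeg, mem_initSeg, Ne, Fin.ext_iff]
  omega

lemma sum_pi_ite_coord {n : ℕ} (ν : Fin n → Fin n → ℝ) (k a : Fin n) (hk : ∑ i, ν k i = 1)
    (f : (Fin n → Fin n) → ℝ) (hf : ∀ i b, f (Function.update i k b) = f i) :
    ∑ i : Fin n → Fin n, (if i k = a then f i * ∏ j, ν j (i j) else 0) =
      ν k a * ∑ i : Fin n → Fin n, f i * ∏ j, ν j (i j) := by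
  set e := Equiv.funSplitAt k (Fin n)
  have hek : ∀ p : Fin n × ({j // j ≠ k} → Fin n), e.symm p k = p.1 := fun p => by
    simp [e, Equiv.funSplitAt]
  have hej : ∀ (p : Fin n × ({j // j ≠ k} → Fin n)) (j : {j // j ≠ k}), e.symm p j = p.2 j :=
    fun p j => by
      have := j.2
      simp [e, Equiv.funSplitAt, this]
  have hff : ∀ b r, f (e.symm (b, r)) = f (e.symm (a, r)) := fun b r => by
    rw [← hf (e.symm (a, r)) b]
    congr 1
    funext j
    by_cases hj : j = k
    · subst hj; rw [hek]; simp
    · rw [Function.update_of_ne hj]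
      exact (hej (b, r) ⟨j, hj⟩).trans (hej (a, r) ⟨j, hj⟩).symm
  have hprod : ∀ p, ∏ j, ν j (e.symm p j) = ν k p.1 * ∏ j : {j // j ≠ k}, ν j (p.2 j) := fun p => by
    rw [Fintype.prod_eq_mul_prod_subtype_ne _ k, hek]
    simp only [hej]
  rw [← e.symm.sum_comp, ← e.symm.sum_comp, Fintype.sum_prod_type, Fintype.sum_prod_type]
  simp only [hek, hprod, hff]
  rw [Finset.sum_eq_single a (fun b _ hb => by simp [hb]) (by simp)]
  have : ∀ b, ∑ r, f (e.symm (a, r)) * (ν k b * ∏ j : {j // j ≠ k}, ν j (r j)) =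
      ν k b * ∑ r, f (e.symm (a, r)) * ∏ j : {j // j ≠ k}, ν j (r j) := fun b => by
    rw [Finset.mul_sum]
    exact Finset.sum_congr rfl fun r _ => by ring
  simp only [this]
  rw [← Finset.sum_mul, hk, one_mul]
  simpa using this a

/-- The first `k` factors of the product `⋯ u₂ u₁ u₀` selected by the indices `i`. -/
def partialProd {n : ℕ} (u : Fin n → Fin n → Equiv.Perm (Fin n)) (k : ℕ) (i : Fin n → Fin n) :
    Equiv.Perm (Fin n) :=
  (((List.finRange n).take k).map fun j => (u j (i j))⁻¹).prod⁻¹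

/-- The law of `partialProd u k` under a product measure. -/
def partialLaw {n : ℕ} (u : Fin n → Fin n → Equiv.Perm (Fin n)) (ν : Fin n → Fin n → ℝ) (k : ℕ)
    (X : Equiv.Perm (Fin n)) : ℝ :=
  ∑ i : Fin n → Fin n, (if partialProd u k i = X then 1 else 0) * ∏ j, ν j (i j)

variable {n : ℕ} {u : Fin n → Fin n → Equiv.Perm (Fin n)} {ν : Fin n → Fin n → ℝ}

lemma partialProd_succ (k : ℕ) (hk : k < n) (i : Fin n → Fin n) :
    partialProd u (k + 1) i = u ⟨k, hk⟩ (i ⟨k, hk⟩) * partialProd u k i := by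
  unfold partialProd
  rw [List.take_add_one, List.getElem?_eq_getElem (by simpa using hk)]
  simp

lemma partialProd_update (k : Fin n) (i : Fin n → Fin n) (b : Fin n) :
    partialProd u k (Function.update i k b) = partialProd u k i := by
  unfold partialProd
  congr 2
  apply List.map_congr_left
  intro j hj
  have : j ≠ k := by
    rintro rfl
    obtain ⟨a, ha, h⟩ := List.mem_take_iff_getElem.1 hj
    simp at h ha
    have := congrArg Fin.val h
    simp at this
    omega
  rw [Function.update_of_ne this]

lemma partialProd_fixesOff
    (hu : ∀ j i : Fin n, i ≤ j → FixesOff (initSeg n (j + 1)) (u j i))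
    {i : Fin n → Fin n} (hi : ∀ j, i j ≤ j) (k : ℕ) (hk : k ≤ n) :
    FixesOff (initSeg n k) (partialProd u k i) := by
  induction k with
  | zero => intro v _; simp [partialProd]
  | succ k ih =>
    rw [partialProd_succ k hk]
    refine (hu ⟨k, hk⟩ _ (hi _)).mul ((ih (by omega)).mono ?_)
    intro l hl
    rw [mem_initSeg] at hl ⊢
    exact hl.trans k.lt_succ_self

lemma partialLaw_isPr (hν : ∀ j, IsPr (ν j)) (k : ℕ) : IsPr (partialLaw u ν k) := by
  refine ⟨fun X => Finset.sum_nonneg fun i _ => mul_nonneg (by split_ifs <;> norm_num)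
    (Finset.prod_nonneg fun j _ => (hν j).nonneg _), ?_⟩
  unfold partialLaw
  rw [Finset.sum_comm]
  simp only [ite_mul, one_mul, zero_mul, Finset.sum_ite_eq, Finset.mem_univ, if_true]
  rw [← Fintype.piFinset_univ, ← Finset.prod_univ_sum]
  simp [(hν _).sum_one]

lemma exists_of_partialLaw_ne_zero {k : ℕ} {X : Equiv.Perm (Fin n)} (h : partialLaw u ν k X ≠ 0) :
    ∃ i : Fin n → Fin n, partialProd u k i = X ∧ ∀ j, ν j (i j) ≠ 0 := by
  obtain ⟨i, -, hi⟩ := Finset.exists_ne_zero_of_sum_ne_zero h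
  refine ⟨i, ?_, fun j => ?_⟩
  · by_contra h0; simp [h0] at hi
  · exact (Finset.prod_ne_zero_iff.1 (right_ne_zero_of_mul hi)) j (by simp)

lemma partialLaw_split (hν : ∀ j, IsPr (ν j)) (hνu : ∀ j i, j < i → ν j i = 0)
    (hub : ∀ j i, u j i j = i)
    (hu : ∀ j i : Fin n, i ≤ j → FixesOff (initSeg n (j + 1)) (u j i))
    (k : Fin n) :
    Split (initSeg n (k + 1)) (partialLaw u ν (k + 1)) k (ν k)
      (partialLaw u ν k) (u k) := by
  have hle : ∀ i : Fin n → Fin n, (∀ j, ν j (i j) ≠ 0) → ∀ j, i j ≤ j := fun i hi j => by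
    by_contra h
    exact hi j (hνu j _ (not_le.1 h))
  have hoff : ∀ ρ, partialLaw u ν k ρ ≠ 0 → FixesOff (initSeg n k) ρ := fun ρ hρ => by
    obtain ⟨i, rfl, hi⟩ := exists_of_partialLaw_ne_zero hρ
    exact partialProd_fixesOff hu (hle i hi) k k.2.le
  refine ⟨hν k, fun i hi => hνu k i ?_, partialLaw_isPr hν _, ?_, hub k, fun i hi => hu k i ?_,
    fun X => ?_⟩
  · rw [mem_initSeg] at hi
    exact Fin.lt_def.2 (by omega)
  · rw [initSeg_succ_erase]; exact hoff
  · rw [mem_initSeg] at hi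
    exact Fin.le_def.2 (by omega)
  · have := sum_pi_ite_coord ν k (X k) (hν k).sum_one
      (fun i => if partialProd u k i = (u k (X k))⁻¹ * X then 1 else 0)
      (fun i b => by rw [partialProd_update])
    unfold partialLaw
    rw [← this]
    refine Finset.sum_congr rfl fun i _ => ?_
    by_cases h0 : ∏ j, ν j (i j) = 0
    · simp [h0]
    have hi : ∀ j, ν j (i j) ≠ 0 := fun j => Finset.prod_ne_zero_iff.1 h0 j (by simp)
    have hfix : partialProd u k i k = k :=
      partialProd_fixesOff hu (hle i hi) k k.2.le k (by rw [mem_initSeg]; omega)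
    rw [partialProd_succ k k.2]
    simp only [Fin.eta]
    by_cases hX : u k (i k) * partialProd u k i = X
    · have hik : i k = X k := by rw [← hX, Equiv.Perm.mul_apply, hfix, hub]
      rw [if_pos hX, if_pos hik, if_pos (by rw [← hik, ← hX]; group)]
    · rw [if_neg hX, zero_mul]
      split_ifs with h1 h2
      · exact absurd (by rw [h2, h1]; group) hX
      · simp
      · rfl

lemma partialLaw_splitChain {ℓ : ℕ} (hν : ∀ j, IsPr (ν j)) (hνu : ∀ j i, j < i → ν j i = 0)
    (hub : ∀ j i, u j i j = i)
    (hu : ∀ j i : Fin n, i ≤ j → FixesOff (initSeg n (j + 1)) (u j i))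
    (hu1 : ∀ j, u j j = 1) (hul : ∀ j i, (u j i).support.card ≤ ℓ) (k : ℕ) (hk : k ≤ n) :
    SplitChain True ℓ (initSeg n k) (partialLaw u ν k) := by
  induction k with
  | zero =>
    have : initSeg n 0 = ∅ := by ext l; simp [mem_initSeg]
    rw [this]
    exact .nil _
  | succ k ih =>
    refine .step (x := ⟨k, hk⟩) (by rw [mem_initSeg]; exact k.lt_succ_self)
      (partialLaw_split hν hνu hub hu ⟨k, hk⟩) (fun _ => ⟨hu1 _, fun i _ => hul _ i⟩) ?_
    have := initSeg_succ_erase (⟨k, hk⟩ : Fin n)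
    simp only at this
    rw [this]
    exact ih (by omega)

end LocalBase

section LocalBaseApply

lemma Orb_le {n : ℕ} {G : Subgroup (Equiv.Perm (Fin n))} {j i : Fin n} (h : i ∈ Orb G j) :
    i ≤ j := by
  obtain ⟨σ, hσ, rfl⟩ := h
  by_contra hlt
  rw [not_le] at hlt
  exact hlt.ne' (σ.injective (hσ.2 _ hlt))

/-- The inverses of the elements of a local base, completed by transpositions. -/
def baseInv {n : ℕ} (G : Subgroup (Equiv.Perm (Fin n))) (t : Fin n → Fin n → Equiv.Perm (Fin n))
    (j i : Fin n) : Equiv.Perm (Fin n) :=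
  if i ∈ Orb G j ∧ (j : ℕ) ≠ 0 then (t i j)⁻¹ else Equiv.swap i j

variable {n ℓ : ℕ} {G : Subgroup (Equiv.Perm (Fin n))} {t : Fin n → Fin n → Equiv.Perm (Fin n)}

lemma baseInv_apply (ht : IsLocalBase ℓ G t) (j i : Fin n) : baseInv G t j i j = i := by
  unfold baseInv
  split_ifs with h
  · rw [Equiv.Perm.inv_eq_iff_eq]
    by_cases hij : i = j
    · rw [hij, (ht j h.2).1, Equiv.Perm.one_apply]
    · exact ((ht j h.2).2 i h.1 hij).2.1.symm
  · simp

lemma baseInv_self (ht : IsLocalBase ℓ G t) (j : Fin n) : baseInv G t j j = 1 := by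
  unfold baseInv
  split_ifs with h
  · rw [(ht j h.2).1, inv_one]
  · rw [Equiv.swap_self]; rfl

lemma baseInv_fixesOff (ht : IsLocalBase ℓ G t) (j i : Fin n) (hij : i ≤ j) :
    FixesOff (initSeg n (j + 1)) (baseInv G t j i) := by
  rcases hij.eq_or_lt with rfl | hij
  · rw [baseInv_self ht]; exact .one
  unfold baseInv
  split_ifs with h
  · refine FixesOff.inv fun v hv => ((ht j h.2).2 i h.1 hij.ne).1.2 v ?_
    rw [mem_initSeg] at hv
    exact Fin.lt_def.2 (by omega)
  · exact .swap (mem_initSeg.2 (by rw [Fin.lt_def] at hij; omega)) (mem_initSeg.2 (by omega))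

lemma baseInv_support (hℓ : 2 ≤ ℓ) (ht : IsLocalBase ℓ G t) (j i : Fin n) :
    (baseInv G t j i).support.card ≤ ℓ := by
  by_cases hij : i = j
  · rw [hij, baseInv_self ht]; simp
  unfold baseInv
  split_ifs with h
  · rw [Equiv.Perm.support_inv]
    have := ((ht j h.2).2 i h.1 hij).2.2
    unfold degree at this
    convert this using 2
    ext v
    simp
  · rw [Equiv.Perm.card_support_swap hij]; exact hℓ

lemma baseInv_mem (ht : IsLocalBase ℓ G t) {j i : Fin n} (h : i ∈ Orb G j) :
    baseInv G t j i ∈ G := by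
  by_cases hij : i = j
  · rw [hij, baseInv_self ht]; exact G.one_mem
  have hj : (j : ℕ) ≠ 0 := fun h0 => hij (le_antisymm (Orb_le h) (Fin.le_def.2 (by omega)))
  unfold baseInv
  rw [if_pos ⟨h, hj⟩]
  exact G.inv_mem ((ht j hj).2 i h hij).1.1

lemma partialProd_baseInv (hn : 2 ≤ n) (ht : IsLocalBase ℓ G t) {i : Fin n → Fin n}
    (hi : ∀ j, i j ∈ Orb G j) :
    partialProd (baseInv G t) n i = (UT t i)⁻¹ := by
  obtain ⟨m, rfl⟩ : ∃ m, n = m + 1 := ⟨n - 1, by omega⟩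
  unfold partialProd UT
  rw [List.take_of_length_le (by simp), List.finRange_succ]
  have h0 : i 0 = 0 := le_antisymm (Orb_le (hi 0)) (Fin.zero_le _)
  simp only [List.map_cons, List.prod_cons, h0, baseInv_self ht, inv_one, one_mul]
  congr 2
  apply List.map_congr_left
  intro j hj
  obtain ⟨k, -, rfl⟩ := List.mem_map.1 hj
  simp [baseInv, hi]

theorem MemMT.splitChain (hn : 2 ≤ n) (hℓ : 2 ≤ ℓ) (ht : IsLocalBase ℓ G t)
    {μ : Equiv.Perm (Fin n) → ℝ} (hμ : MemMT G t μ) (hinv : ∀ σ ∈ G, μ σ = μ σ⁻¹) :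
    IsPr μ ∧ (∀ σ ∉ G, μ σ = 0) ∧ SplitChain True ℓ Finset.univ μ := by
  obtain ⟨ν, hν, hμν⟩ := hμ
  have hνp : ∀ j, IsPr (ν j) := fun j => ⟨(hν j).1, (hν j).2.2⟩
  have hνo : ∀ j i, ν j i ≠ 0 → i ∈ Orb G j := fun j i h => by
    by_contra h0; exact h ((hν j).2.1 i h0)
  have e1 : ∀ X, partialLaw (baseInv G t) ν n X = μ X⁻¹ := fun X => by
    rw [hμν]
    refine Finset.sum_congr rfl fun i _ => ?_
    by_cases h0 : ∏ j, ν j (i j) = 0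
    · simp [h0]
    have hi : ∀ j, i j ∈ Orb G j := fun j => hνo j _ (Finset.prod_ne_zero_iff.1 h0 j (by simp))
    rw [partialProd_baseInv hn ht hi]
    simp [inv_eq_iff_eq_inv]
  have hG : ∀ X, partialLaw (baseInv G t) ν n X ≠ 0 → X ∈ G := fun X hX => by
    obtain ⟨i, rfl, hi⟩ := exists_of_partialLaw_ne_zero hX
    refine G.inv_mem (Subgroup.list_prod_mem _ fun y hy => ?_)
    obtain ⟨j, -, rfl⟩ := List.mem_map.1 hy
    exact G.inv_mem (baseInv_mem ht (hνo _ _ (hi j)))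
  have hμG : ∀ σ ∉ G, μ σ = 0 := fun σ hσ => by
    by_contra h0
    refine hσ (inv_mem_iff.1 (hG σ⁻¹ ?_))
    rwa [e1, inv_inv]
  have e2 : partialLaw (baseInv G t) ν n = μ := funext fun X => by
    rw [e1]
    by_cases hX : X ∈ G
    · exact (hinv X hX).symm
    · rw [hμG _ hX, hμG _ (by simpa using hX)]
  refine ⟨e2 ▸ partialLaw_isPr hνp n, hμG, ?_⟩
  have := partialLaw_splitChain (u := baseInv G t) hνp
    (fun j i hij => (hν j).2.1 i fun h => (Orb_le h).not_gt hij) (baseInv_apply ht)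
    (baseInv_fixesOff ht) (baseInv_self ht) (baseInv_support hℓ ht) n le_rfl
  rw [e2] at this
  convert this
  ext l
  simp [mem_initSeg]

end LocalBaseApply

/-! ### The triangle inequality for the weak cost and the transport inequality -/

section Triangle

lemma sum_mul_add_sq_le {X : Type*} [Fintype X] {w a b : X → ℝ} (hw : ∀ x, 0 ≤ w x) :
    ∑ x, w x * (a x + b x) ^ 2 ≤
      (√(∑ x, w x * a x ^ 2) + √(∑ x, w x * b x ^ 2)) ^ 2 := by
  have hsq : ∀ f : X → ℝ, ∀ x, (√(w x) * f x) ^ 2 = w x * f x ^ 2 := fun f x => by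
    rw [mul_pow, Real.sq_sqrt (hw x)]
  have h := Real.sum_mul_le_sqrt_mul_sqrt Finset.univ (fun x => √(w x) * a x)
    (fun x => √(w x) * b x)
  simp only [hsq] at h
  have hprod : ∀ x, √(w x) * a x * (√(w x) * b x) = w x * (a x * b x) := fun x => by
    rw [mul_mul_mul_comm, Real.mul_self_sqrt (hw x)]
  simp only [hprod] at h
  have hA : 0 ≤ ∑ x, w x * a x ^ 2 := Finset.sum_nonneg fun x _ => mul_nonneg (hw x) (sq_nonneg _)
  have hB : 0 ≤ ∑ x, w x * b x ^ 2 := Finset.sum_nonneg fun x _ => mul_nonneg (hw x) (sq_nonneg _)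
  have e : ∑ x, w x * (a x + b x) ^ 2 =
      ∑ x, w x * a x ^ 2 + 2 * ∑ x, w x * (a x * b x) + ∑ x, w x * b x ^ 2 := by
    rw [Finset.mul_sum, ← Finset.sum_add_distrib, ← Finset.sum_add_distrib]
    exact Finset.sum_congr rfl fun x _ => by ring
  rw [e, add_sq, Real.sq_sqrt hA, Real.sq_sqrt hB]
  linarith

lemma sum_mul_sq_le_of_kernel {X : Type*} [Fintype X] {p f : X → ℝ} (hp : ∀ x, 0 ≤ p x)
    (h1 : ∑ x, p x = 1) : (∑ x, p x * f x) ^ 2 ≤ ∑ x, p x * f x ^ 2 := by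
  have h := (Even.convexOn_pow (𝕜 := ℝ) (n := 2) even_two).map_sum_le (t := Finset.univ) (w := p)
    (p := f) (fun x _ => hp x) h1 (fun x _ => Set.mem_univ _)
  simpa [smul_eq_mul] using h

lemma IsKernel.exists_row_one {X : Type*} [Fintype X] [DecidableEq X] {ν₁ ν₂ : X → ℝ}
    {p : X → X → ℝ} (h : IsKernel ν₁ ν₂ p) :
    ∃ p', IsKernel ν₁ ν₂ p' ∧ (∀ σ, ∑ τ, p' σ τ = 1) ∧ ∀ σ, ν₁ σ ≠ 0 → p' σ = p σ := by
  refine ⟨fun σ => if ν₁ σ = 0 then Pi.single σ 1 else p σ, ⟨fun σ τ => ?_, fun σ hσ => ?_,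
    fun τ => ?_⟩, fun σ => ?_, fun σ hσ => if_neg hσ⟩
  · split_ifs
    · by_cases h : τ = σ
      · subst h; simp
      · simp [h]
    · exact h.nonneg σ τ
  · simp only [if_neg hσ]; exact h.row σ hσ
  · rw [← h.marg τ]
    refine Finset.sum_congr rfl fun σ _ => ?_
    by_cases h0 : ν₁ σ = 0 <;> simp [h0]
  · dsimp only
    split_ifs with h0
    · simp
    · exact h.row σ h0

/-- Probability, under the kernel `p` started at `σ`, that the image of `i` changes. -/
def miss {V : Type*} [Fintype V] [DecidableEq V] (p : Equiv.Perm V → Equiv.Perm V → ℝ)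
    (σ : Equiv.Perm V) (i : V) : ℝ :=
  ∑ τ, p σ τ * (if σ i ≠ τ i then 1 else 0)

variable {V : Type*} [Fintype V] [DecidableEq V] {ν₁ ν₂ μ : Equiv.Perm V → ℝ}

lemma miss_nonneg {p : Equiv.Perm V → Equiv.Perm V → ℝ} (hp : ∀ σ τ, 0 ≤ p σ τ)
    (σ : Equiv.Perm V) (i : V) : 0 ≤ miss p σ i :=
  Finset.sum_nonneg fun τ _ => mul_nonneg (hp σ τ) (by split_ifs <;> norm_num)

lemma sum_miss_sq (p : Equiv.Perm V → Equiv.Perm V → ℝ) (σ : Equiv.Perm V) :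
    ∑ i, miss p σ i ^ 2 = ∑ l, hit p σ l ^ 2 := by
  rw [← Equiv.sum_comp σ fun l => hit p σ l ^ 2]
  refine Finset.sum_congr rfl fun i _ => ?_
  congr 1
  refine Finset.sum_congr rfl fun τ _ => ?_
  have : σ⁻¹ (σ i) = i := by simp
  rw [this]
  by_cases h : σ i = τ i
  · simp [h]
  · simp [h, Ne.symm h]

/-- Composition of the kernels `p` and `r`. -/
def kerComp {X : Type*} [Fintype X] (p r : X → X → ℝ) (σ τ : X) : ℝ := ∑ ρ, p σ ρ * r ρ τ

lemma IsKernel.comp {X : Type*} [Fintype X] {ν₁ μ ν₂ : X → ℝ} {p r : X → X → ℝ}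
    (hp : IsKernel ν₁ μ p) (hp1 : ∀ σ, ∑ τ, p σ τ = 1) (hr : IsKernel μ ν₂ r)
    (hr1 : ∀ σ, ∑ τ, r σ τ = 1) :
    IsKernel ν₁ ν₂ (kerComp p r) ∧ ∀ σ, ∑ τ, kerComp p r σ τ = 1 := by
  have h1 : ∀ σ, ∑ τ, kerComp p r σ τ = 1 := fun σ => by
    unfold kerComp
    rw [Finset.sum_comm]
    simp only [← Finset.mul_sum, hr1, mul_one, hp1]
  refine ⟨⟨fun σ τ => Finset.sum_nonneg fun ρ _ => mul_nonneg (hp.nonneg _ _) (hr.nonneg _ _),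
    fun σ _ => h1 σ, fun τ => ?_⟩, h1⟩
  unfold kerComp
  simp only [Finset.mul_sum]
  rw [Finset.sum_comm, ← hr.marg τ]
  refine Finset.sum_congr rfl fun ρ _ => ?_
  rw [← hp.marg ρ, Finset.sum_mul]
  exact Finset.sum_congr rfl fun σ _ => by ring

lemma miss_kerComp_le {p r : Equiv.Perm V → Equiv.Perm V → ℝ} (hp : ∀ σ τ, 0 ≤ p σ τ)
    (hr : ∀ σ τ, 0 ≤ r σ τ) (hr1 : ∀ σ, ∑ τ, r σ τ = 1) (σ : Equiv.Perm V) (i : V) :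
    miss (kerComp p r) σ i ≤ miss p σ i + ∑ ρ, p σ ρ * miss r ρ i := by
  unfold miss kerComp
  simp only [Finset.sum_mul]
  rw [Finset.sum_comm, ← Finset.sum_add_distrib]
  refine Finset.sum_le_sum fun ρ _ => ?_
  simp only [mul_assoc]
  rw [← Finset.mul_sum, ← mul_add]
  refine mul_le_mul_of_nonneg_left ?_ (hp σ ρ)
  have : (if σ i ≠ ρ i then (1 : ℝ) else 0) = ∑ τ, r ρ τ * (if σ i ≠ ρ i then (1 : ℝ) else 0) := by
    rw [← Finset.sum_mul, hr1, one_mul]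
  rw [this, ← Finset.sum_add_distrib]
  refine Finset.sum_le_sum fun τ _ => ?_
  rw [← mul_add]
  refine mul_le_mul_of_nonneg_left ?_ (hr ρ τ)
  by_cases h1 : σ i = ρ i
  · simp [h1]
  · simp only [ne_eq, h1, not_false_eq_true, if_true]
    split_ifs <;> norm_num

/-- The square root of the weak cost satisfies the triangle inequality. -/
lemma exists_kernel_cost_le {p r : Equiv.Perm V → Equiv.Perm V → ℝ} (hν₁ : ∀ σ, 0 ≤ ν₁ σ)
    (hp : IsKernel ν₁ μ p) (hr : IsKernel μ ν₂ r) :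
    ∃ k, IsKernel ν₁ ν₂ k ∧ (∀ σ, ∑ τ, k σ τ = 1) ∧ ∑ σ, ν₁ σ * ∑ i, miss k σ i ^ 2 ≤
      (√(∑ σ, ν₁ σ * ∑ i, miss p σ i ^ 2) + √(∑ σ, μ σ * ∑ i, miss r σ i ^ 2)) ^ 2 := by
  obtain ⟨p', hp', hp1, hpp⟩ := hp.exists_row_one
  obtain ⟨r', hr', hr1, hrr⟩ := hr.exists_row_one
  have cost_eq : ∀ {m : Equiv.Perm V → ℝ} {s s' : Equiv.Perm V → Equiv.Perm V → ℝ},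
      (∀ σ, m σ ≠ 0 → s' σ = s σ) →
      ∑ σ, m σ * ∑ i, miss s σ i ^ 2 = ∑ σ, m σ * ∑ i, miss s' σ i ^ 2 := fun {m _ _} h => by
    refine Finset.sum_congr rfl fun σ _ => ?_
    by_cases h0 : m σ = 0
    · rw [h0, zero_mul, zero_mul]
    · simp only [miss, h σ h0]
  rw [cost_eq hpp, cost_eq hrr]
  obtain ⟨hk, hk1⟩ := hp'.comp hp1 hr' hr1
  refine ⟨_, hk, hk1, ?_⟩
  have pair : ∀ f : Equiv.Perm V → V → ℝ, ∑ σ, ν₁ σ * ∑ i, f σ i ^ 2 =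
      ∑ x : Equiv.Perm V × V, ν₁ x.1 * f x.1 x.2 ^ 2 := fun f => by
    rw [Fintype.sum_prod_type]
    simp only [Finset.mul_sum]
  have cost_le_sum : ∑ σ, ν₁ σ * ∑ i, miss (kerComp p' r') σ i ^ 2 ≤
      ∑ σ, ν₁ σ * ∑ i, (miss p' σ i + ∑ ρ, p' σ ρ * miss r' ρ i) ^ 2 := by
    refine Finset.sum_le_sum fun σ _ => mul_le_mul_of_nonneg_left ?_ (hν₁ σ)
    refine Finset.sum_le_sum fun i _ => ?_
    exact pow_le_pow_left₀ (miss_nonneg hk.nonneg σ i)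
      (miss_kerComp_le hp'.nonneg hr'.nonneg hr1 σ i) 2
  have sum_sq_le : ∑ σ, ν₁ σ * ∑ i, (∑ ρ, p' σ ρ * miss r' ρ i) ^ 2 ≤
      ∑ σ, μ σ * ∑ i, miss r' σ i ^ 2 := by
    calc _ ≤ ∑ σ, ν₁ σ * ∑ i, ∑ ρ, p' σ ρ * miss r' ρ i ^ 2 := by
          refine Finset.sum_le_sum fun σ _ => mul_le_mul_of_nonneg_left ?_ (hν₁ σ)
          exact Finset.sum_le_sum fun i _ => sum_mul_sq_le_of_kernel (hp'.nonneg σ) (hp1 σ)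
      _ = ∑ σ, ∑ ρ, ν₁ σ * p' σ ρ * ∑ i, miss r' ρ i ^ 2 := by
          refine Finset.sum_congr rfl fun σ _ => ?_
          rw [Finset.sum_comm, Finset.mul_sum]
          exact Finset.sum_congr rfl fun ρ _ => by rw [← Finset.mul_sum, mul_assoc]
      _ = _ := by
          rw [Finset.sum_comm]
          exact Finset.sum_congr rfl fun ρ _ => by rw [← Finset.sum_mul, hp'.marg]
  refine cost_le_sum.trans ?_
  rw [pair, pair (miss p')]
  refine (sum_mul_add_sq_le (w := fun x : Equiv.Perm V × V => ν₁ x.1)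
    (a := fun x => miss p' x.1 x.2) (b := fun x => ∑ ρ, p' x.1 ρ * miss r' ρ x.2)
    fun x => hν₁ x.1).trans ?_
  rw [pair (fun σ i => ∑ ρ, p' σ ρ * miss r' ρ i)] at sum_sq_le
  gcongr

lemma TransportBound.exists_kernel {N : ℝ} (h : TransportBound N Finset.univ μ) (hμ : IsPr μ)
    (hν₁ : IsPr ν₁) (hν₂ : IsPr ν₂) (h₁ : ∀ X, μ X = 0 → ν₁ X = 0)
    (h₂ : ∀ X, μ X = 0 → ν₂ X = 0) :
    ∃ k, IsKernel ν₁ ν₂ k ∧ (∀ σ, ∑ τ, k σ τ = 1) ∧ ∑ σ, ν₁ σ * ∑ i, miss k σ i ^ 2 ≤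
      2 * (N + 1) ^ 2 * (√(ent ν₁ μ) + √(ent ν₂ μ)) ^ 2 := by
  obtain ⟨p, hp, hpc⟩ := h ν₁ μ hν₁ hμ h₁ (fun _ => id) (Or.inr rfl) _ subset_rfl 0 (fun _ => le_rfl)
  obtain ⟨r, hr, hrc⟩ := h μ ν₂ hμ hν₂ (fun _ => id) h₂ (Or.inl rfl) _ subset_rfl 0 (fun _ => le_rfl)
  simp only [Pi.zero_apply, zero_add, ent_self, add_zero, ne_eq, OfNat.ofNat_ne_zero,
    not_false_eq_true, zero_pow, Finset.sum_const_zero, mul_zero, ← sum_miss_sq] at hpc hrc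
  obtain ⟨k, hk, hk1, hkc⟩ := exists_kernel_cost_le hν₁.nonneg hp hr
  refine ⟨k, hk, hk1, hkc.trans ?_⟩
  calc _ ≤ (√(2 * (N + 1) ^ 2 * ent ν₁ μ) + √(2 * (N + 1) ^ 2 * ent ν₂ μ)) ^ 2 := by gcongr
    _ = _ := by
      have hC : 0 ≤ 2 * (N + 1) ^ 2 := by positivity
      rw [Real.sqrt_mul hC, Real.sqrt_mul hC, ← mul_add, mul_pow,
        Real.sq_sqrt hC]

end Triangle

lemma parenT2_le {n : ℕ} {ν₁ ν₂ : Equiv.Perm (Fin n) → ℝ} (hν₁ : ∀ σ, 0 ≤ ν₁ σ)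
    {k : Equiv.Perm (Fin n) → Equiv.Perm (Fin n) → ℝ} (hk : IsKernel ν₁ ν₂ k)
    (hk1 : ∀ σ, ∑ τ, k σ τ = 1) : parenT2 ν₁ ν₂ ≤ ∑ σ, ν₁ σ * ∑ i, miss k σ i ^ 2 := by
  refine csInf_le ⟨0, ?_⟩ ⟨k, hk.nonneg, hk1, hk.marg, ?_⟩
  · rintro w ⟨p, -, -, -, rfl⟩
    exact Finset.sum_nonneg fun σ _ => mul_nonneg (hν₁ σ) (Finset.sum_nonneg fun i _ => sq_nonneg _)
  · unfold miss
    congr!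

theorem parenT2_le_relEnt {n : ℕ} {N c : ℝ} (hN : 2 ≤ N) (hc : 2 * (N + 1) ^ 2 ≤ c)
    {μ ν₁ ν₂ : Equiv.Perm (Fin n) → ℝ} (hμ : IsPr μ) (hs : IsSpread N Finset.univ μ)
    (hν₁ : IsPr ν₁) (hν₂ : IsPr ν₂) :
    ENNReal.ofReal (parenT2 ν₁ ν₂) ≤
      ENNReal.ofReal c * (relEnt ν₁ μ ^ ((1 : ℝ) / 2) + relEnt ν₂ μ ^ ((1 : ℝ) / 2)) ^ 2 := by
  have hc0 : 0 < c := lt_of_lt_of_le (by positivity) hc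
  have htop : ∀ a : ENNReal, a = ⊤ → ENNReal.ofReal c * a ^ 2 = ⊤ := fun a ha => by
    rw [ha, ENNReal.top_pow two_ne_zero, ENNReal.mul_top (by simpa using hc0)]
  have hhalf : (0 : ℝ) < 1 / 2 := by norm_num
  by_cases h₁ : ∀ X, μ X = 0 → ν₁ X = 0
  swap
  · rw [htop _ (by rw [relEnt, if_neg h₁, ENNReal.top_rpow_of_pos hhalf, top_add])]
    exact le_top
  by_cases h₂ : ∀ X, μ X = 0 → ν₂ X = 0
  swap
  · rw [htop _ (by rw [relEnt.eq_def ν₂, if_neg h₂, ENNReal.top_rpow_of_pos hhalf, add_top])]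
    exact le_top
  have hrel : ∀ {ν : Equiv.Perm (Fin n) → ℝ}, IsPr ν → (∀ X, μ X = 0 → ν X = 0) →
      relEnt ν μ ^ ((1 : ℝ) / 2) = ENNReal.ofReal √(ent ν μ) := fun hν h => by
    rw [relEnt, if_pos h, Real.sqrt_eq_rpow, ← ENNReal.ofReal_rpow_of_nonneg
      (ent_nonneg hν hμ h) hhalf.le]
    rfl
  rw [hrel hν₁ h₁, hrel hν₂ h₂, ← ENNReal.ofReal_add (Real.sqrt_nonneg _) (Real.sqrt_nonneg _),
    ← ENNReal.ofReal_pow (by positivity), ← ENNReal.ofReal_mul hc0.le]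
  refine ENNReal.ofReal_le_ofReal ?_
  obtain ⟨k, hk, hk1, hkc⟩ := (hs.transportBound hN).exists_kernel hμ hν₁ hν₂ h₁ h₂
  refine (parenT2_le hν₁.nonneg hk hk1).trans (hkc.trans ?_)
  gcongr

/-- Transport-entropy inequality for the weak cost `T⌒₂`, for invariant measures in
the class `M_T` on a normal subgroup of `S_n`, with `c² = 8(ℓ-1)² + 2`. -/
theorem stmt8 {n ℓ : ℕ} (hn : 2 ≤ n) (hℓ : 2 ≤ ℓ) (hℓn : ℓ ≤ n)
    (G : Subgroup (Equiv.Perm (Fin n))) (hnorm : G.Normal)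
    (t : Fin n → Fin n → Equiv.Perm (Fin n)) (ht : IsLocalBase ℓ G t)
    (μ : Equiv.Perm (Fin n) → ℝ) (hμ : MemMT G t μ)
    (hinv₁ : ∀ σ ∈ G, μ σ = μ σ⁻¹)
    (hinv₂ : ∀ σ ∈ G, ∀ τ : Equiv.Perm (Fin n), μ σ = μ (τ⁻¹ * σ * τ))
    (ν₁ ν₂ : Equiv.Perm (Fin n) → ℝ)
    (hν₁ : IsProbOn ν₁ (G : Set (Equiv.Perm (Fin n))))
    (hν₂ : IsProbOn ν₂ (G : Set (Equiv.Perm (Fin n)))) :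
    ENNReal.ofReal (parenT2 ν₁ ν₂) ≤
      ENNReal.ofReal (2 * (8 * ((ℓ : ℝ) - 1) ^ 2 + 2)) *
        (relEnt ν₁ μ ^ ((1 : ℝ) / 2) + relEnt ν₂ μ ^ ((1 : ℝ) / 2)) ^ 2 := by
  obtain ⟨hμp, hμG, hch⟩ := hμ.splitChain hn hℓ ht hinv₁
  have hconj : ConjInvOn Finset.univ μ := fun w _ X => by
    by_cases hX : X ∈ G
    · have := hinv₂ X hX w⁻¹
      rw [inv_inv] at this
      exact this.symm
    · have hX' : w * X * w⁻¹ ∉ G := fun h => hX (by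
        have := hnorm.conj_mem _ h w⁻¹
        simpa [mul_assoc] using this)
      rw [hμG _ hX, hμG _ hX']
  have hℓ' : (2 : ℝ) ≤ ℓ := by exact_mod_cast hℓ
  exact parenT2_le_relEnt (by linarith)
    (by nlinarith [sq_nonneg (2 * ((ℓ : ℝ) - 1) - 1)]) hμp (hch.isSpread hℓ rfl hconj)
    ⟨hν₁.1, hν₁.2.2⟩ ⟨hν₂.1, hν₂.2.2⟩

end
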